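/- arXiv:1510.04319 — 2 statements merged into one kernel-verified Lean document; each statement's English description precedes it below -/
import Mathlib

section
/- Let Γ be a finite set of permutations each of which starts with 1 and has at most one descent. Then for every n ≥ 1, U_{Γ,n}(y) = Σ (−y)^{ℓ}, where the sum ranges over all pairs (B, σ) with B = (b_1, …, b_ℓ) a composition of n and σ ∈ S_n such that: (1) σ is increasing within each brick, i.e., σ has no descent at any position interior to a brick b_i; (2) the first entries of the bricks form an increasing sequence, reading from left to right; (3) for each i < ℓ, if σ has a descent at the boundary between bricks b_i and b_{i+1}, then there is a Γ-match of σ contained entirely in the positions covered by b_i and b_{i+1}; and (4) if the identity permutation 1 2 ⋯ (k+1) belongs to Γ, then b_i ≤ k for all i. -/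
open Polynomial

/-- The reduction of a list of distinct integers: replace the i-th smallest entry by i. -/
def redL (l : List ℕ) : List ℕ :=
  l.map (fun x => (l.countP (fun y => decide (y < x))) + 1)

/-- The number of descents of a list. -/
def desL (l : List ℕ) : ℕ :=
  (l.zip l.tail).countP (fun p => decide (p.2 < p.1))

/-- `σ` has a `Γ`-match: some consecutive factor of length at least 2 reduces to a member of `Γ`. -/
def HasMatch (Γ : Set (List ℕ)) (l : List ℕ) : Prop :=
  ∃ i j : ℕ, 1 ≤ j ∧ i + j + 1 ≤ l.length ∧ redL ((l.drop i).take (j + 1)) ∈ Γ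

open scoped Classical in
/-- The set of permutations of `{1,…,n}` (in one-line notation, as lists) with no `Γ`-match. -/
noncomputable def NMfinset (Γ : Set (List ℕ)) (n : ℕ) : Finset (List ℕ) :=
  ((List.range' 1 n).permutations.toFinset).filter (fun l => ¬ HasMatch Γ l)

/-- `NM_{Γ,n}(y) = Σ_{σ ∈ NM_n(Γ)} y^{1+des(σ)}` for `n ≥ 1`, and `NM_{Γ,0}(y) = 1`. -/
noncomputable def NMpoly (Γ : Set (List ℕ)) (n : ℕ) : Polynomial ℚ :=
  if n = 0 then 1 else ∑ l ∈ NMfinset Γ n, X ^ (1 + desL l)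

/-- Conditions (1)–(3) on a pair `(B, σ)`: increasing within each brick, first entries of
bricks increasing, and every descent at a brick boundary is covered by a `Γ`-match lying in
the two bricks around it. -/
def FixedPt (Γ : Set (List ℕ)) (n : ℕ) (c : Composition n) (σ : List ℕ) : Prop :=
  (∀ p : ℕ, p + 1 < n → (¬ ∃ i, i < c.length ∧ c.sizeUpTo i = p + 1) →
    σ.getD p 0 < σ.getD (p + 1) 0) ∧
  (∀ i : ℕ, i + 1 < c.length →
    σ.getD (c.sizeUpTo i) 0 < σ.getD (c.sizeUpTo (i + 1)) 0) ∧
  (∀ i : ℕ, i + 1 < c.length →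
    σ.getD (c.sizeUpTo (i + 1)) 0 < σ.getD (c.sizeUpTo (i + 1) - 1) 0 →
    ∃ a j : ℕ, 1 ≤ j ∧ c.sizeUpTo i ≤ a ∧ a + j + 1 ≤ c.sizeUpTo (i + 2) ∧
      redL ((σ.drop a).take (j + 1)) ∈ Γ)


namespace GM

/-- some match is contained in the positions `[p,q)` -/
def MI (M : ℕ → ℕ → Prop) (p q : ℕ) : Prop := ∃ a b, p ≤ a ∧ b ≤ q ∧ M a b

/-- validity of a list of bricks (last brick first) -/
def V (A : ℕ → Prop) (M : ℕ → ℕ → Prop) : List ℕ → Prop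
  | [] => True
  | b :: c => 1 ≤ b ∧ (∀ p, c.sum ≤ p → p + 1 < c.sum + b → A p) ∧ ¬ MI M c.sum (c.sum + b) ∧
      V A M c ∧ (∀ b' c', c = b' :: c' → A (c.sum - 1) ∨ MI M c'.sum (c.sum + b))

lemma V_congr (A A' : ℕ → Prop) (M M' : ℕ → ℕ → Prop) (c : List ℕ)
    (hA : ∀ p, p + 1 < c.sum → (A p ↔ A' p)) (hM : ∀ a b, b ≤ c.sum → (M a b ↔ M' a b)) :
    V A M c ↔ V A' M' c := by
  induction c with
  | nil => simp [V]
  | cons b c ih =>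
    simp only [List.sum_cons] at hA hM
    have hMI : ∀ p q, q ≤ b + c.sum → (MI M p q ↔ MI M' p q) := by
      intro p q hq
      unfold MI
      refine exists_congr fun a => exists_congr fun b' => ?_
      constructor
      · rintro ⟨h1, h2, h3⟩
        exact ⟨h1, h2, (hM _ _ (by omega)).1 h3⟩
      · rintro ⟨h1, h2, h3⟩
        exact ⟨h1, h2, (hM _ _ (by omega)).2 h3⟩
    unfold V
    refine and_congr_right fun hb => ?_
    rw [ih (fun p hp => hA p (by omega)) (fun a b hb => hM a b (by omega)),
      hMI c.sum (c.sum + b) (by omega)]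
    refine and_congr ?_ (and_congr_right fun _ => and_congr_right fun hv => ?_)
    · refine forall_congr' fun p => forall_congr' fun h1 => forall_congr' fun h2 => ?_
      exact hA p (by omega)
    · refine forall_congr' fun b' => forall_congr' fun c' => forall_congr' fun h => ?_
      rw [hMI c'.sum (c.sum + b) (by omega)]
      have h0 : 1 ≤ c.sum := by
        subst h
        have := hv.1
        simp only [List.sum_cons]
        omega
      rw [hA _ (by omega)]

end GM

namespace GM

lemma exists_run (A : ℕ → Prop) (n k : ℕ) (hk : k < n) :
    ∃ R, 1 ≤ R ∧ k + R ≤ n ∧ (∀ p, k ≤ p → p + 1 < k + R → A p) ∧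
      (k + R < n → ¬ A (k + R - 1)) := by
  obtain ⟨m, hm⟩ : ∃ m, n = k + 1 + m := ⟨n - k - 1, by omega⟩
  induction m generalizing k with
  | zero => exact ⟨1, le_rfl, by omega, fun p _ _ => by omega, fun _ => by omega⟩
  | succ m ih =>
    by_cases hA : A k
    · obtain ⟨R, h1, h2, h3, h4⟩ := ih (k + 1) (by omega) (by omega)
      refine ⟨R + 1, by omega, by omega, fun p hp hp' => ?_, fun h => ?_⟩
      · rcases Nat.eq_or_lt_of_le hp with rfl | hp
        · exact hA
        · exact h3 p hp (by omega)
      · have := h4 (by omega)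
        rwa [show k + (R + 1) - 1 = k + 1 + R - 1 by omega]
    · exact ⟨1, le_rfl, by omega, fun p _ _ => by omega, fun _ => by simpa using hA⟩

lemma run_unique (A : ℕ → Prop) (n k R R' : ℕ)
    (h : 1 ≤ R ∧ k + R ≤ n ∧ (∀ p, k ≤ p → p + 1 < k + R → A p) ∧ (k + R < n → ¬ A (k + R - 1)))
    (h' : 1 ≤ R' ∧ k + R' ≤ n ∧ (∀ p, k ≤ p → p + 1 < k + R' → A p) ∧
      (k + R' < n → ¬ A (k + R' - 1))) : R = R' := by
  obtain ⟨h1, h2, h3, h4⟩ := h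
  obtain ⟨h1', h2', h3', h4'⟩ := h'
  rcases Nat.lt_trichotomy R R' with h | h | h
  · exact absurd (h3' (k + R - 1) (by omega) (by omega)) (h4 (by omega))
  · exact h
  · exact absurd (h3 (k + R' - 1) (by omega) (by omega)) (h4' (by omega))

open scoped Classical in
/-- the sign-reversing move -/
noncomputable def move (A : ℕ → Prop) (M : ℕ → ℕ → Prop) (n : ℕ) (r : ℕ → ℕ) (c : List ℕ) :
    List ℕ :=
  if c.sum < n ∧ V A M (r c.sum :: c) then r c.sum :: c else c.tail

lemma MI_mono {M : ℕ → ℕ → Prop} {p q p' q' : ℕ} (hp : p' ≤ p) (hq : q ≤ q') (h : MI M p q) :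
    MI M p' q' := by
  obtain ⟨a, b, h1, h2, h3⟩ := h
  exact ⟨a, b, by omega, by omega, h3⟩

lemma E_run (A : ℕ → Prop) (n : ℕ) (E : ℕ → ℕ)
    (hE1 : ∀ k, k < n → (k + 1 = n ∨ ¬ A k) → E k = E (k + 1) + 1)
    (hE2 : ∀ k, k + 1 < n → A k → E k = E (k + 1)) (R k : ℕ)
    (h : 1 ≤ R ∧ k + R ≤ n ∧ (∀ p, k ≤ p → p + 1 < k + R → A p) ∧
      (k + R < n → ¬ A (k + R - 1))) : E k = E (k + R) + 1 := by
  obtain ⟨h1, h2, h3, h4⟩ := h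
  have key : ∀ m, m + 1 ≤ R → E k = E (k + m) := by
    intro m
    induction m with
    | zero => intro _; rfl
    | succ m ih =>
      intro hm
      rw [ih (by omega), hE2 (k + m) (by omega) (h3 _ (by omega) (by omega))]
      rfl
  rw [key (R - 1) (by omega), hE1 (k + (R - 1)) (by omega), show k + (R - 1) + 1 = k + R by omega]
  rcases Nat.lt_or_ge (k + R) n with h | h
  · right
    rw [show k + (R - 1) = k + R - 1 by omega]
    exact h4 h
  · left; omega

open scoped Classical in
lemma core_list (A : ℕ → Prop) (M : ℕ → ℕ → Prop) (n : ℕ) (hn : 1 ≤ n)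
    (hM : ∀ a b p q, M a b → a ≤ p → p < q → q + 1 < b → A p ∨ A q)
    (E : ℕ → ℕ)
    (hE1 : ∀ k, k < n → (k + 1 = n ∨ ¬ A k) → E k = E (k + 1) + 1)
    (hE2 : ∀ k, k + 1 < n → A k → E k = E (k + 1))
    (s : Finset (List ℕ))
    (hs : ∀ c, c ∈ s ↔ V A M c ∧ c.sum ≤ n ∧ ¬ MI M c.sum n) :
    ∑ c ∈ s, ((-X : ℚ[X]) ^ c.length * X ^ (E c.sum)) = 0 := by
  choose! r hr using exists_run A n
  -- adding a run
  have hadd : ∀ c, V A M c → ¬ MI M c.sum n → c.sum < n →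
      (∀ b' c', c = b' :: c' → A (c.sum - 1) ∨ MI M c'.sum (c.sum + r c.sum)) →
      V A M (r c.sum :: c) := by
    intro c hV hfree hlt hlast
    obtain ⟨h1, h2, h3, h4⟩ := hr _ hlt
    exact ⟨h1, h3, fun h => hfree (MI_mono le_rfl h2 h), hV, hlast⟩
  -- case A
  have hA : ∀ c ∈ s, c.sum < n ∧ V A M (r c.sum :: c) → r c.sum :: c ∈ s ∧
      ¬ ((r c.sum :: c).sum < n ∧ V A M (r (r c.sum :: c).sum :: r c.sum :: c)) := by
    rintro c hc ⟨hlt, hV⟩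
    obtain ⟨h1, h2, h3, h4⟩ := hr _ hlt
    obtain ⟨g1, g2, g3⟩ := (hs _).1 hc
    constructor
    · rw [hs]
      refine ⟨hV, ?_, fun h => g3 (MI_mono ?_ le_rfl h)⟩
      · simp only [List.sum_cons]; omega
      · simp only [List.sum_cons]; omega
    · rintro ⟨hlt', hV'⟩
      have hlt2 : c.sum + r c.sum < n := by
        simp only [List.sum_cons] at hlt'; omega
      obtain ⟨i1, i2, i3, i4⟩ := hr _ hlt'
      rcases hV'.2.2.2.2 _ _ rfl with h | h
      · apply h4 hlt2
        rw [List.sum_cons, add_comm] at h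
        exact h
      · exact g3 (MI_mono le_rfl i2 h)
  -- case B
  have hB : ∀ c ∈ s, ¬ (c.sum < n ∧ V A M (r c.sum :: c)) →
      ∃ c', c = r c'.sum :: c' ∧ c'.sum < n ∧ c' ∈ s := by
    intro c hc hnot
    obtain ⟨g1, g2, g3⟩ := (hs _).1 hc
    cases c with
    | nil =>
      exfalso
      apply hnot
      have h0 : ([] : List ℕ).sum < n := by simp only [List.sum_nil]; omega
      exact ⟨h0, hadd _ g1 g3 h0 (by simp)⟩
    | cons b c' =>
      have hb := g1.1
      have hsum : (b :: c').sum = c'.sum + b := by rw [List.sum_cons, add_comm]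
      have hlt : c'.sum < n := by omega
      have hdesc : c'.sum + b < n → ¬ A (c'.sum + b - 1) ∧
          ¬ MI M c'.sum (c'.sum + b + r (c'.sum + b)) := by
        intro h
        by_contra hcon
        apply hnot
        refine ⟨by omega, hadd _ g1 g3 (by omega) ?_⟩
        intro b1 c1 h1
        obtain ⟨rfl, rfl⟩ := List.cons.inj h1
        rw [hsum]
        tauto
      have hbr : r c'.sum = b := by
        apply run_unique A n c'.sum _ _ (hr _ hlt)
        exact ⟨hb, by omega, g1.2.1, fun h => (hdesc h).1⟩
      refine ⟨c', by rw [hbr], hlt, ?_⟩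
      rw [hs]
      refine ⟨g1.2.2.2.1, by omega, ?_⟩
      rintro ⟨a, e, ha, he, hm⟩
      rw [hsum] at g3 g2
      rcases Nat.eq_or_lt_of_le g2 with h | h
      · exact g1.2.2.1 ⟨a, e, ha, by omega, hm⟩
      · obtain ⟨d1, d2⟩ := hdesc h
        obtain ⟨i1, i2, i3, i4⟩ := hr _ h
        by_cases ha' : c'.sum + b ≤ a
        · exact g3 ⟨a, e, ha', he, hm⟩
        · by_cases he' : e ≤ c'.sum + b + r (c'.sum + b)
          · exact d2 ⟨a, e, ha, he', hm⟩
          · rcases hM a e (c'.sum + b - 1) (c'.sum + b + r (c'.sum + b) - 1) hm (by omega)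
              (by omega) (by omega) with h' | h'
            · exact d1 h'
            · exact i4 (by omega) h'
  have hw : ∀ c : List ℕ, c.sum < n →
      (-X : ℚ[X]) ^ c.length * X ^ (E c.sum) +
      (-X : ℚ[X]) ^ (r c.sum :: c).length * X ^ (E (r c.sum :: c).sum) = 0 := by
    intro c hc
    rw [E_run A n E hE1 hE2 _ _ (hr _ hc), List.sum_cons, List.length_cons, add_comm (r c.sum)]
    ring
  refine Finset.sum_involution (fun c _ => move A M n r c) ?_ ?_ ?_ ?_
  · intro c hc
    unfold move
    split_ifs with h
    · exact hw c h.1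
    · obtain ⟨c', rfl, h2, h3⟩ := hB c hc h
      rw [add_comm]
      exact hw c' h2
  · intro c hc _
    unfold move
    split_ifs with h
    · intro h'
      have := congrArg List.length h'
      simp at this
    · obtain ⟨c', rfl, h2, h3⟩ := hB c hc h
      intro h'
      have := congrArg List.length h'
      simp at this
  · intro c hc
    unfold move
    split_ifs with h
    · exact (hA c hc h).1
    · obtain ⟨c', rfl, h2, h3⟩ := hB c hc h
      exact h3
  · intro c hc
    by_cases h : c.sum < n ∧ V A M (r c.sum :: c)
    · have h1 : move A M n r c = r c.sum :: c := if_pos h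
      rw [h1]
      exact if_neg (hA c hc h).2
    · have h1 : move A M n r c = c.tail := if_neg h
      rw [h1]
      obtain ⟨c', rfl, h2, h3⟩ := hB c hc h
      exact if_pos ⟨h2, ((hs _).1 hc).1⟩

lemma V_pos {A : ℕ → Prop} {M : ℕ → ℕ → Prop} {c : List ℕ} (h : V A M c) : ∀ b ∈ c, 0 < b := by
  induction c with
  | nil => simp
  | cons b c ih =>
    intro x hx
    rcases List.mem_cons.1 hx with rfl | hx
    · exact h.1
    · exact ih h.2.2.2.1 x hx

open scoped Classical in
/-- signed count of valid compositions -/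
noncomputable def fA (A : ℕ → Prop) (M : ℕ → ℕ → Prop) (k : ℕ) : ℚ[X] :=
  ∑ c : Composition k, if V A M c.blocks.reverse then (-X : ℚ[X]) ^ c.length else 0

open scoped Classical in
lemma core (A : ℕ → Prop) (M : ℕ → ℕ → Prop) (n : ℕ) (hn : 1 ≤ n)
    (hM : ∀ a b p q, M a b → a ≤ p → p < q → q + 1 < b → A p ∨ A q)
    (E : ℕ → ℕ)
    (hE1 : ∀ k, k < n → (k + 1 = n ∨ ¬ A k) → E k = E (k + 1) + 1)
    (hE2 : ∀ k, k + 1 < n → A k → E k = E (k + 1)) :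
    ∑ k ∈ Finset.range (n + 1), fA A M k * (if MI M k n then 0 else X ^ (E k)) = 0 := by
  let t : ℕ → Finset (List ℕ) := fun k =>
    (Finset.univ.image (fun c : Composition k => c.blocks.reverse)).filter
      (fun c => V A M c ∧ ¬ MI M c.sum n)
  have ht : ∀ k c, c ∈ t k ↔ V A M c ∧ c.sum = k ∧ ¬ MI M c.sum n := by
    intro k c
    simp only [t, Finset.mem_filter, Finset.mem_image, Finset.mem_univ, true_and]
    constructor
    · rintro ⟨⟨c, rfl⟩, h1, h2⟩
      exact ⟨h1, by simp, h2⟩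
    · rintro ⟨h1, h2, h3⟩
      refine ⟨⟨⟨c.reverse, ?_, ?_⟩, by simp⟩, h1, h3⟩
      · intro i hi
        exact V_pos h1 i (by simpa using hi)
      · simpa using h2
  refine Eq.trans ?_ (core_list A M n hn hM E hE1 hE2 ((Finset.range (n + 1)).biUnion t) ?_)
  · rw [Finset.sum_biUnion]
    · refine Finset.sum_congr rfl fun k hk => ?_
      simp only [t]
      rw [Finset.sum_filter, Finset.sum_image]
      · unfold fA
        rw [Finset.sum_mul]
        refine Finset.sum_congr rfl fun c _ => ?_
        have : c.blocks.reverse.sum = k := by simp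
        rw [this]
        by_cases h1 : V A M c.blocks.reverse <;> by_cases h2 : MI M k n <;>
          simp [h1, h2, Composition.length]
      · intro c _ c' _ h
        exact Composition.ext (List.reverse_injective h)
    · intro k _ k' _ hkk
      rw [Function.onFun, Finset.disjoint_left]
      intro c h1 h2
      rw [ht] at h1 h2
      exact hkk (h1.2.1.symm.trans h2.2.1)
  · intro c
    simp only [Finset.mem_biUnion, Finset.mem_range, ht]
    constructor
    · rintro ⟨k, hk, h1, h2, h3⟩
      exact ⟨h1, by omega, h3⟩
    · rintro ⟨h1, h2, h3⟩
      exact ⟨c.sum, by omega, h1, rfl, h3⟩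

end GM

namespace GM

lemma desL_cons_cons (x y : ℕ) (t : List ℕ) :
    desL (x :: y :: t) = desL (y :: t) + (if y < x then 1 else 0) := by
  simp [desL, List.countP_cons]

lemma drop_eq (w : List ℕ) (k : ℕ) (hk : k < w.length) :
    w.drop k = w.getD k 0 :: w.drop (k + 1) := by
  rw [List.drop_eq_getElem_cons hk, List.getD_eq_getElem _ _ hk]

lemma desL_drop (w : List ℕ) (k : ℕ) (hk : k + 1 < w.length) :
    desL (w.drop k) = desL (w.drop (k + 1)) +
      (if w.getD (k + 1) 0 < w.getD k 0 then 1 else 0) := by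
  rw [drop_eq w k (by omega), drop_eq w (k + 1) hk, desL_cons_cons]

lemma desL_drop_anti (w : List ℕ) (k m : ℕ) : desL (w.drop (k + m)) ≤ desL (w.drop k) := by
  induction m with
  | zero => simp
  | succ m ih =>
    refine le_trans ?_ ih
    rcases Nat.lt_or_ge (k + m + 1) w.length with h | h
    · rw [desL_drop w (k + m) h, ← add_assoc]
      omega
    · rw [List.drop_eq_nil_of_le (by omega : w.length ≤ k + (m + 1))]
      simp [desL]

lemma two_desc (w : List ℕ) (p q : ℕ) (hpq : p < q) (hq : q + 1 < w.length)
    (h1 : w.getD (p + 1) 0 < w.getD p 0) (h2 : w.getD (q + 1) 0 < w.getD q 0) :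
    2 ≤ desL w := by
  have e1 := desL_drop w p (by omega)
  have e2 := desL_drop w q (by omega)
  rw [if_pos h1] at e1
  rw [if_pos h2] at e2
  have e3 := desL_drop_anti w (p + 1) (q - (p + 1))
  have e4 := desL_drop_anti w 0 p
  rw [show p + 1 + (q - (p + 1)) = q by omega] at e3
  simp only [zero_add, List.drop_zero] at e4
  omega

/-- `φ` is strictly increasing on the entries of `l` -/
def SI (φ : ℕ → ℕ) (l : List ℕ) : Prop := ∀ x ∈ l, ∀ y ∈ l, x < y → φ x < φ y

lemma SI.iff {φ : ℕ → ℕ} {l : List ℕ} (h : SI φ l) {x y : ℕ} (hx : x ∈ l) (hy : y ∈ l) :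
    φ x < φ y ↔ x < y := by
  constructor
  · intro hlt
    rcases Nat.lt_trichotomy x y with h' | h' | h'
    · exact h'
    · subst h'; omega
    · have := h y hy x hx h'
      omega
  · exact h x hx y hy

lemma redL_map {φ : ℕ → ℕ} {l : List ℕ} (h : SI φ l) : redL (l.map φ) = redL l := by
  unfold redL
  rw [List.map_map]
  refine List.map_congr_left fun x hx => ?_
  simp only [Function.comp, List.countP_map, Nat.add_right_cancel_iff]
  refine List.countP_congr fun y hy => ?_
  simp [h.iff hy hx]

lemma desL_map {φ : ℕ → ℕ} {l : List ℕ} (h : SI φ l) : desL (l.map φ) = desL l := by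
  induction l with
  | nil => rfl
  | cons x t ih =>
    cases t with
    | nil => rfl
    | cons y t =>
      have ih' := ih (fun a ha b hb => h a (List.mem_cons_of_mem _ ha) b (List.mem_cons_of_mem _ hb))
      simp only [List.map_cons] at ih' ⊢
      rw [desL_cons_cons, desL_cons_cons, ih']
      congr 1
      simp only [h.iff (x := y) (y := x) (by simp) (by simp)]

lemma redL_SI (l : List ℕ) : SI (fun x => (l.countP (fun y => decide (y < x))) + 1) l := by
  intro x hx y hy hxy
  simp only [Nat.add_lt_add_iff_right]
  obtain ⟨l1, l2, rfl⟩ := List.append_of_mem hx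
  have h1 : ∀ l : List ℕ, l.countP (fun z => decide (z < x)) ≤ l.countP (fun z => decide (z < y)) := by
    intro l
    refine List.countP_mono_left fun z _ hz => ?_
    simp at hz ⊢
    omega
  have e1 := h1 l1
  have e2 := h1 l2
  simp only [List.countP_append, List.countP_cons, lt_irrefl, decide_false, hxy, decide_true]
  simp
  omega

lemma desL_redL (l : List ℕ) : desL (redL l) = desL l := desL_map (redL_SI l)

/-- ascent at position `p` -/
def Aw (w : List ℕ) (p : ℕ) : Prop := w.getD p 0 < w.getD (p + 1) 0

/-- match in positions `[a,b)` -/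
def Mw (Γ : Set (List ℕ)) (w : List ℕ) (a b : ℕ) : Prop :=
  a + 2 ≤ b ∧ b ≤ w.length ∧ redL ((w.drop a).take (b - a)) ∈ Γ

lemma getD_slice (w : List ℕ) (a m i : ℕ) (hi : i < m) :
    ((w.drop a).take m).getD i 0 = w.getD (a + i) 0 := by
  simp [List.getD_eq_getElem?_getD, hi]

lemma getD_inj {w : List ℕ} (hw : w.Nodup) {p q : ℕ} (hp : p < w.length) (hq : q < w.length)
    (h : w.getD p 0 = w.getD q 0) : p = q := by
  rw [List.getD_eq_getElem _ _ hp, List.getD_eq_getElem _ _ hq] at h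
  exact (List.Nodup.getElem_inj_iff hw).1 h

lemma not_Aw {w : List ℕ} (hw : w.Nodup) {p : ℕ} (hp : p + 1 < w.length) :
    ¬ Aw w p ↔ w.getD (p + 1) 0 < w.getD p 0 := by
  unfold Aw
  have : w.getD p 0 ≠ w.getD (p + 1) 0 := fun h => by
    have := getD_inj hw (by omega) hp h
    omega
  omega

lemma Mw_one (Γ : Set (List ℕ)) (hΓ : ∀ τ ∈ Γ, desL τ ≤ 1) (w : List ℕ) (hw : w.Nodup)
    (a b p q : ℕ) (hM : Mw Γ w a b) (hp : a ≤ p) (hpq : p < q) (hq : q + 1 < b) :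
    Aw w p ∨ Aw w q := by
  obtain ⟨h1, h2, h3⟩ := hM
  have h4 := hΓ _ h3
  rw [desL_redL] at h4
  by_contra hcon
  rw [not_or, not_Aw hw (by omega), not_Aw hw (by omega)] at hcon
  have := two_desc ((w.drop a).take (b - a)) (p - a) (q - a) (by omega) (by simp; omega)
    (by rw [getD_slice _ _ _ _ (by omega), getD_slice _ _ _ _ (by omega)]
        rw [show a + (p - a + 1) = p + 1 by omega, show a + (p - a) = p by omega]; exact hcon.1)
    (by rw [getD_slice _ _ _ _ (by omega), getD_slice _ _ _ _ (by omega)]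
        rw [show a + (q - a + 1) = q + 1 by omega, show a + (q - a) = q by omega]; exact hcon.2)
  omega

lemma HasMatch_drop (Γ : Set (List ℕ)) (w : List ℕ) (k : ℕ) (hk : k ≤ w.length) :
    HasMatch Γ (w.drop k) ↔ MI (Mw Γ w) k w.length := by
  unfold HasMatch MI Mw
  constructor
  · rintro ⟨i, j, hj, hl, hm⟩
    rw [List.length_drop] at hl
    rw [List.drop_drop] at hm
    refine ⟨k + i, k + i + j + 1, by omega, by omega, by omega, by omega, ?_⟩
    rw [show k + i + j + 1 - (k + i) = j + 1 by omega]
    exact hm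
  · rintro ⟨a, b, h1, h2, h3, h4, h5⟩
    refine ⟨a - k, b - a - 1, by omega, by rw [List.length_drop]; omega, ?_⟩
    rw [List.drop_drop, show k + (a - k) = a by omega, show b - a - 1 + 1 = b - a by omega]
    exact h5

/-- signed count of brick decompositions of a word of length `k` -/
noncomputable def fL (Γ : Set (List ℕ)) (k : ℕ) (u : List ℕ) : ℚ[X] := fA (Aw u) (Mw Γ u) k

open scoped Classical in
noncomputable def gL (Γ : Set (List ℕ)) (v : List ℕ) : ℚ[X] :=
  if HasMatch Γ v then 0 else X ^ (if v = [] then 0 else 1 + desL v)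

open scoped Classical in
lemma fA_congr (A A' : ℕ → Prop) (M M' : ℕ → ℕ → Prop) (k : ℕ)
    (hA : ∀ p, p + 1 < k → (A p ↔ A' p)) (hM : ∀ a b, b ≤ k → (M a b ↔ M' a b)) :
    fA A M k = fA A' M' k := by
  unfold fA
  refine Finset.sum_congr rfl fun c _ => ?_
  have hs : c.blocks.reverse.sum = k := by simp
  have := V_congr A A' M M' c.blocks.reverse (by rwa [hs]) (by rwa [hs])
  exact if_congr this rfl rfl

lemma fL_take (Γ : Set (List ℕ)) (w : List ℕ) (k : ℕ) (hk : k ≤ w.length) :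
    fL Γ k (w.take k) = fL Γ k w := by
  unfold fL
  apply fA_congr
  · intro p hp
    have h := getD_slice w 0 k p (by omega)
    have h' := getD_slice w 0 k (p + 1) (by omega)
    simp only [List.drop_zero, zero_add] at h h'
    unfold Aw
    rw [h, h']
  · intro a b hb
    unfold Mw
    rw [List.drop_take, List.take_take, List.length_take]
    refine and_congr_right fun hab => ?_
    rw [min_eq_left (by omega : b - a ≤ k - a), min_eq_left hk]
    refine and_congr_left fun _ => ?_
    omega

open scoped Classical in
lemma per_word (Γ : Set (List ℕ)) (hΓ : ∀ τ ∈ Γ, desL τ ≤ 1) (w : List ℕ) (hw : w.Nodup)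
    (hn : 1 ≤ w.length) :
    ∑ k ∈ Finset.range (w.length + 1), fL Γ k (w.take k) * gL Γ (w.drop k) = 0 := by
  rw [← core (Aw w) (Mw Γ w) w.length hn (Mw_one Γ hΓ w hw)
    (fun k => if k < w.length then 1 + desL (w.drop k) else 0)]
  · refine Finset.sum_congr rfl fun k hk => ?_
    have hk' : k ≤ w.length := by simpa [Nat.lt_succ_iff] using hk
    rw [fL_take _ _ _ hk']
    congr 1
    unfold gL
    refine if_congr (HasMatch_drop Γ w k hk') rfl ?_
    simp only [List.drop_eq_nil_iff]
    by_cases h : k < w.length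
    · simp [h, not_le.2 h]
    · simp [h, not_lt.1 h]
  · intro k hk h
    simp only [hk, if_true]
    by_cases hk1 : k + 1 < w.length
    · have h : ¬ Aw w k := h.resolve_left (by omega)
      rw [not_Aw hw hk1] at h
      rw [desL_drop w k hk1, if_pos h, if_pos hk1]
      omega
    · rw [if_neg hk1, drop_eq w k hk, List.drop_eq_nil_of_le (by omega)]
      simp [desL]
  · intro k hk h
    have h' : ¬ (w.getD (k + 1) 0 < w.getD k 0) := by unfold Aw at h; omega
    rw [if_pos (by omega), if_pos hk, desL_drop w k hk, if_neg h', add_zero]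

lemma SI.slice {φ : ℕ → ℕ} {l : List ℕ} (h : SI φ l) (a m : ℕ) : SI φ ((l.drop a).take m) :=
  fun x hx y hy => h x (List.mem_of_mem_drop (List.mem_of_mem_take hx)) y
    (List.mem_of_mem_drop (List.mem_of_mem_take hy))

lemma fL_map (Γ : Set (List ℕ)) {φ : ℕ → ℕ} {l : List ℕ} (h : SI φ l) :
    fL Γ l.length (l.map φ) = fL Γ l.length l := by
  unfold fL
  apply fA_congr
  · intro p hp
    unfold Aw
    have e1 : p < l.length := by omega
    rw [List.getD_eq_getElem _ _ hp, List.getD_eq_getElem _ _ e1,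
      List.getD_eq_getElem _ _ (by simpa using e1), List.getD_eq_getElem _ _ (by simpa using hp),
      List.getElem_map, List.getElem_map]
    exact h.iff (by simp) (by simp)
  · intro a b hb
    unfold Mw
    rw [← List.map_drop, ← List.map_take, redL_map (h.slice _ _), List.length_map]

open scoped Classical in
lemma gL_map (Γ : Set (List ℕ)) {φ : ℕ → ℕ} {l : List ℕ} (h : SI φ l) :
    gL Γ (l.map φ) = gL Γ l := by
  unfold gL
  have : HasMatch Γ (l.map φ) ↔ HasMatch Γ l := by
    unfold HasMatch
    refine exists_congr fun i => exists_congr fun j => ?_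
    rw [← List.map_drop, ← List.map_take, redL_map (h.slice _ _), List.length_map]
  refine if_congr this rfl ?_
  simp only [desL_map h, List.map_eq_nil_iff]

end GM

namespace GM

/-- all orderings of a finite set -/
noncomputable def PS (S : Finset ℕ) : Finset (List ℕ) := S.toList.permutations.toFinset

lemma mem_PS {S : Finset ℕ} {w : List ℕ} : w ∈ PS S ↔ w.Nodup ∧ w.toFinset = S := by
  unfold PS
  rw [List.mem_toFinset, List.mem_permutations]
  constructor
  · intro h
    exact ⟨h.nodup_iff.2 S.nodup_toList, by rw [List.toFinset_eq_of_perm _ _ h, Finset.toList_toFinset]⟩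
  · rintro ⟨h1, rfl⟩
    exact (List.toFinset_toList h1).symm

lemma PS_length {S : Finset ℕ} {w : List ℕ} (h : w ∈ PS S) : w.length = S.card := by
  obtain ⟨h1, rfl⟩ := mem_PS.1 h
  exact (List.toFinset_card_of_nodup h1).symm

lemma mem_PS_mem {S : Finset ℕ} {w : List ℕ} (h : w ∈ PS S) (x : ℕ) : x ∈ w ↔ x ∈ S := by
  obtain ⟨h1, rfl⟩ := mem_PS.1 h
  simp

lemma range'_PS (n : ℕ) : (List.range' 1 n).permutations.toFinset = PS (Finset.Icc 1 n) := by
  ext w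
  rw [mem_PS, List.mem_toFinset, List.mem_permutations]
  have e : (List.range' 1 n).toFinset = Finset.Icc 1 n := by
    ext x; simp [List.mem_range'_1]; omega
  constructor
  · intro h
    exact ⟨h.nodup_iff.2 List.nodup_range', by rw [List.toFinset_eq_of_perm _ _ h, e]⟩
  · rintro ⟨h1, h2⟩
    exact List.perm_of_nodup_nodup_toFinset_eq h1 List.nodup_range' (h2.trans e.symm)

/-- standardizing the alphabet -/
lemma sum_std (S : Finset ℕ) (F : List ℕ → ℚ[X])
    (hF : ∀ φ l, l.length = S.card → SI φ l → F (l.map φ) = F l) :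
    ∑ w ∈ PS S, F w = ∑ w ∈ PS (Finset.Icc 1 S.card), F w := by
  let φ : ℕ → ℕ := fun x => (S.filter (· < x)).card + 1
  have hφ : ∀ x ∈ S, ∀ y ∈ S, x < y → φ x < φ y := by
    intro x hx y hy hxy
    simp only [φ, Nat.add_lt_add_iff_right]
    apply Finset.card_lt_card
    rw [Finset.ssubset_iff_of_subset]
    · exact ⟨x, by simp [hx, hxy], by simp⟩
    · intro z hz
      simp only [Finset.mem_filter] at hz ⊢
      exact ⟨hz.1, by omega⟩
  have hinj : Set.InjOn φ S := by
    intro x hx y hy h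
    rcases Nat.lt_trichotomy x y with h' | h' | h'
    · have := hφ x hx y hy h'; omega
    · exact h'
    · have := hφ y hy x hx h'; omega
  have himg : S.image φ = Finset.Icc 1 S.card := by
    apply Finset.eq_of_subset_of_card_le
    · intro z hz
      obtain ⟨x, hx, rfl⟩ := Finset.mem_image.1 hz
      simp only [φ, Finset.mem_Icc]
      refine ⟨by omega, ?_⟩
      apply Finset.card_lt_card
      rw [Finset.ssubset_iff_of_subset (Finset.filter_subset _ _)]
      exact ⟨x, hx, by simp⟩
    · rw [Finset.card_image_of_injOn hinj]; simp
  refine Finset.sum_bij (fun w _ => w.map φ) ?_ ?_ ?_ ?_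
  · intro w hw
    obtain ⟨h1, h2⟩ := mem_PS.1 hw
    rw [mem_PS]
    refine ⟨List.Nodup.map_on ?_ h1, ?_⟩
    · intro x hx y hy h
      exact hinj ((mem_PS_mem hw x).1 hx) ((mem_PS_mem hw y).1 hy) h
    · rw [← himg, ← h2]
      ext z; simp
  · intro w hw w' hw' h
    have hl : w.length = w'.length := by rw [PS_length hw, PS_length hw']
    apply List.ext_getElem hl
    intro i h1 h2
    have := List.getElem_of_eq h (i := i) (by simpa using h1)
    simp only [List.getElem_map] at this
    exact hinj ((mem_PS_mem hw _).1 (by simp)) ((mem_PS_mem hw' _).1 (by simp)) this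
  · intro v hv
    let ψ := Function.invFunOn φ (S : Set ℕ)
    have hv' : ∀ z ∈ v, ψ z ∈ S ∧ φ (ψ z) = z := by
      intro z hz
      have : z ∈ S.image φ := by rw [himg]; exact (mem_PS_mem hv z).1 hz
      obtain ⟨x, hx, rfl⟩ := Finset.mem_image.1 this
      exact ⟨Function.invFunOn_mem ⟨x, hx, rfl⟩, Function.invFunOn_eq ⟨x, hx, rfl⟩⟩
    have hmm : (v.map ψ).map φ = v := by
      rw [List.map_map]
      conv_rhs => rw [← List.map_id v]
      exact List.map_congr_left fun z hz => (hv' z hz).2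
    have hnd : (v.map ψ).Nodup := by
      apply List.Nodup.of_map φ
      rw [hmm]
      exact (mem_PS.1 hv).1
    refine ⟨v.map ψ, ?_, hmm⟩
    rw [mem_PS]
    refine ⟨hnd, ?_⟩
    apply Finset.eq_of_subset_of_card_le
    · intro x hx
      simp only [List.mem_toFinset, List.mem_map] at hx
      obtain ⟨z, hz, rfl⟩ := hx
      exact (hv' z hz).1
    · rw [List.toFinset_card_of_nodup hnd, List.length_map, PS_length hv]
      simp
  · intro w hw
    rw [hF φ w (PS_length hw)]
    intro x hx y hy
    exact hφ x ((mem_PS_mem hw x).1 hx) y ((mem_PS_mem hw y).1 hy)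

lemma sum_split (S : Finset ℕ) (k : ℕ) (hk : k ≤ S.card) (F G : List ℕ → ℚ[X]) :
    ∑ w ∈ PS S, F (w.take k) * G (w.drop k) =
      ∑ T ∈ S.powersetCard k, (∑ u ∈ PS T, F u) * (∑ v ∈ PS (S \ T), G v) := by
  simp only [Finset.sum_mul_sum, ← Finset.sum_product']
  rw [Finset.sum_sigma']
  refine Finset.sum_bij'
    (fun w _ => (⟨(w.take k).toFinset, (w.take k, w.drop k)⟩ : (_ : Finset ℕ) × (List ℕ × List ℕ)))
    (fun x _ => x.2.1 ++ x.2.2) ?_ ?_ ?_ ?_ ?_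
  · intro w hw
    have hl := PS_length hw
    obtain ⟨h1, h2⟩ := mem_PS.1 hw
    have hd := h1
    rw [← List.take_append_drop k w, List.nodup_append] at hd
    obtain ⟨d1, d2, d3⟩ := hd
    simp only [Finset.mem_sigma, Finset.mem_powersetCard, Finset.mem_product, mem_PS]
    refine ⟨⟨?_, ?_⟩, ⟨d1, trivial⟩, d2, ?_⟩
    · rw [← h2]
      intro x hx
      rw [List.mem_toFinset] at hx ⊢
      exact List.mem_of_mem_take hx
    · rw [List.toFinset_card_of_nodup d1, List.length_take, hl]
      omega
    · ext x
      rw [← h2, Finset.mem_sdiff, List.mem_toFinset, List.mem_toFinset, List.mem_toFinset]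
      constructor
      · intro hx
        exact ⟨List.mem_of_mem_drop hx, fun hx' => d3 x hx' x hx rfl⟩
      · rintro ⟨hx, hx'⟩
        rw [← List.take_append_drop k w, List.mem_append] at hx
        exact hx.resolve_left hx'
  · rintro ⟨T, u, v⟩ hx
    simp only [Finset.mem_sigma, Finset.mem_powersetCard, Finset.mem_product, mem_PS] at hx
    obtain ⟨⟨h1, h2⟩, ⟨h3, h4⟩, h5, h6⟩ := hx
    rw [mem_PS]
    constructor
    · rw [List.nodup_append]
      refine ⟨h3, h5, ?_⟩
      rintro x hx y hy rfl
      have a1 : x ∈ T := by rw [← h4]; simpa using hx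
      have a2 : x ∈ S \ T := by rw [← h6]; simpa using hy
      exact (Finset.mem_sdiff.1 a2).2 a1
    · rw [List.toFinset_append, h4, h6]
      exact Finset.union_sdiff_of_subset h1
  · intro w hw
    simp
  · rintro ⟨T, u, v⟩ hx
    simp only [Finset.mem_sigma, Finset.mem_powersetCard, Finset.mem_product] at hx
    obtain ⟨⟨h1, h2⟩, h3, h4⟩ := hx
    have hl : u.length = k := by rw [PS_length h3, h2]
    have e1 : (u ++ v).take k = u := by rw [← hl]; simp
    have e2 : (u ++ v).drop k = v := by rw [← hl]; simp
    simp only [e1, e2, (mem_PS.1 h3).2]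
  · intro w hw
    rfl

lemma sum_conv (Γ : Set (List ℕ)) (n k : ℕ) (hk : k ≤ n) :
    ∑ w ∈ PS (Finset.Icc 1 n), fL Γ k (w.take k) * gL Γ (w.drop k) =
      (n.choose k : ℚ) • ((∑ u ∈ PS (Finset.Icc 1 k), fL Γ k u) *
        (∑ v ∈ PS (Finset.Icc 1 (n - k)), gL Γ v)) := by
  rw [sum_split _ k (by simpa using hk)]
  rw [Finset.sum_congr rfl (g := fun _ => (∑ u ∈ PS (Finset.Icc 1 k), fL Γ k u) *
        (∑ v ∈ PS (Finset.Icc 1 (n - k)), gL Γ v))]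
  · rw [Finset.sum_const, Finset.card_powersetCard, Nat.card_Icc, Nat.add_sub_cancel,
      Nat.cast_smul_eq_nsmul]
  · intro T hT
    obtain ⟨h1, h2⟩ := Finset.mem_powersetCard.1 hT
    have h3 : (Finset.Icc 1 n \ T).card = n - k := by
      rw [Finset.card_sdiff_of_subset h1, h2]; simp
    rw [sum_std T, sum_std (Finset.Icc 1 n \ T), h2, h3]
    · intro φ l _ h
      exact gL_map Γ h
    · intro φ l hl h
      rw [h2] at hl
      rw [← hl]
      exact fL_map Γ h

lemma conv_zero (Γ : Set (List ℕ)) (hΓ : ∀ τ ∈ Γ, desL τ ≤ 1) (n : ℕ) (hn : 1 ≤ n) :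
    ∑ k ∈ Finset.range (n + 1), (n.choose k : ℚ) • ((∑ u ∈ PS (Finset.Icc 1 k), fL Γ k u) *
        (∑ v ∈ PS (Finset.Icc 1 (n - k)), gL Γ v)) = 0 := by
  rw [← Finset.sum_congr rfl fun k hk => sum_conv Γ n k (by simpa [Nat.lt_succ_iff] using hk),
    Finset.sum_comm]
  refine Finset.sum_eq_zero fun w hw => ?_
  have hl : w.length = n := by rw [PS_length hw]; simp
  have := per_word Γ hΓ w (mem_PS.1 hw).1 (by omega)
  rwa [hl] at this

lemma sum_gL (Γ : Set (List ℕ)) (n : ℕ) : ∑ v ∈ PS (Finset.Icc 1 n), gL Γ v = NMpoly Γ n := by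
  unfold NMpoly
  split_ifs with h
  · subst h
    have : PS (Finset.Icc 1 0) = {[]} := by
      ext w
      rw [mem_PS]
      simp
      rintro rfl
      simp
    rw [this, Finset.sum_singleton]
    unfold gL
    have h' : ¬ HasMatch Γ [] := by
      rintro ⟨i, j, h1, h2, _⟩
      simp at h2
    simp [h']
  · unfold NMfinset
    rw [range'_PS, Finset.sum_filter]
    refine Finset.sum_congr rfl fun v hv => ?_
    have hl : v.length = n := by rw [PS_length hv]; simp
    have hv : v ≠ [] := by rintro rfl; simp at hl; omega
    unfold gL
    by_cases hm : HasMatch Γ v <;> simp [hm, hv]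

/-- the inverse sequence is unique -/
lemma uniq (N F U : ℕ → ℚ[X]) (hN : N 0 = 1) (h0 : U 0 = F 0)
    (hF : ∀ n, 1 ≤ n → ∑ k ∈ Finset.range (n + 1), (n.choose k : ℚ) • (F k * N (n - k)) = 0)
    (hU : ∀ n, 1 ≤ n → ∑ k ∈ Finset.range (n + 1), (n.choose k : ℚ) • (U k * N (n - k)) = 0)
    (n : ℕ) : U n = F n := by
  induction n using Nat.strong_induction_on with
  | _ n ih =>
    rcases Nat.eq_zero_or_pos n with rfl | hn
    · exact h0
    · have h1 := hF n hn
      have h2 := hU n hn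
      rw [Finset.sum_range_succ] at h1 h2
      rw [Finset.sum_congr rfl fun k hk => by rw [ih k (Finset.mem_range.1 hk)]] at h2
      have h3 := h2.trans h1.symm
      simpa [hN] using h3

end GM

namespace GM

lemma V_iff (A : ℕ → Prop) (M : ℕ → ℕ → Prop) (l : List ℕ) : V A M l.reverse ↔
    (∀ b ∈ l, 1 ≤ b) ∧
    (∀ i < l.length, ∀ p, (l.take i).sum ≤ p → p + 1 < (l.take (i + 1)).sum → A p) ∧
    (∀ i < l.length, ¬ MI M (l.take i).sum (l.take (i + 1)).sum) ∧
    (∀ i, i + 1 < l.length → A ((l.take (i + 1)).sum - 1) ∨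
      MI M (l.take i).sum (l.take (i + 2)).sum) := by
  induction l using List.reverseRecOn with
  | nil => simp [V]
  | append_singleton l b ih =>
    have t1 : ∀ i, i ≤ l.length → ((l ++ [b]).take i).sum = (l.take i).sum := by
      intro i hi
      rw [List.take_append_of_le_length hi]
    have t2 : ((l ++ [b]).take (l.length + 1)).sum = l.sum + b := by
      rw [List.take_of_length_le (by simp)]; simp
    rw [List.reverse_append, List.reverse_singleton, List.singleton_append]
    unfold V
    rw [ih, List.sum_reverse, List.length_append, List.length_singleton]
    constructor
    · rintro ⟨h1, h2, h3, ⟨i1, i2, i3, i4⟩, h5⟩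
      refine ⟨?_, ?_, ?_, ?_⟩
      · intro x hx
        rcases List.mem_append.1 hx with hx | hx
        · exact i1 x hx
        · rw [List.mem_singleton.1 hx]; exact h1
      · intro i hi
        rcases Nat.lt_or_ge i l.length with h | h
        · rw [t1 i (by omega), t1 (i + 1) (by omega)]
          exact i2 i h
        · obtain rfl : i = l.length := by omega
          rw [t1 _ le_rfl, t2, List.take_length]
          exact h2
      · intro i hi
        rcases Nat.lt_or_ge i l.length with h | h
        · rw [t1 i (by omega), t1 (i + 1) (by omega)]
          exact i3 i h
        · obtain rfl : i = l.length := by omega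
          rw [t1 _ le_rfl, t2, List.take_length]
          exact h3
      · intro i hi
        rcases Nat.lt_or_ge (i + 1) l.length with h | h
        · rw [t1 i (by omega), t1 (i + 1) (by omega), t1 (i + 2) (by omega)]
          exact i4 i h
        · have hi' : i + 1 = l.length := by omega
          rw [t1 i (by omega), show i + 2 = l.length + 1 by omega, t2, hi', t1 _ le_rfl,
            List.take_length]
          cases l using List.reverseRecOn with
          | nil => simp at hi'
          | append_singleton l b' =>
            have := h5 b' l.reverse (by simp)
            rw [List.sum_reverse] at this
            have e : (l ++ [b']).take i = l := by
              simp at hi'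
              rw [hi']; simp
            rw [e]
            exact this
    · rintro ⟨h1, h2, h3, h4⟩
      refine ⟨h1 b (by simp), ?_, ?_, ⟨fun x hx => h1 x (by simp [hx]), ?_, ?_, ?_⟩, ?_⟩
      · have := h2 l.length (by omega)
        rwa [t1 _ le_rfl, t2, List.take_length] at this
      · have := h3 l.length (by omega)
        rwa [t1 _ le_rfl, t2, List.take_length] at this
      · intro i hi
        have := h2 i (by omega)
        rwa [t1 i (by omega), t1 (i + 1) (by omega)] at this
      · intro i hi
        have := h3 i (by omega)
        rwa [t1 i (by omega), t1 (i + 1) (by omega)] at this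
      · intro i hi
        have := h4 i (by omega)
        rwa [t1 i (by omega), t1 (i + 1) (by omega), t1 (i + 2) (by omega)] at this
      · intro b' c' hc
        have hl : l = c'.reverse ++ [b'] := by
          rw [← List.reverse_reverse l, hc]; simp
        have hlen : c'.length + 1 = l.length := by rw [hl]; simp
        have := h4 c'.length (by omega)
        rw [t1 c'.length (by omega), show c'.length + 2 = l.length + 1 by omega, t2, hlen, t1 _ le_rfl,
            List.take_length] at this
        have e : l.take c'.length = c'.reverse := by
          rw [hl, ← List.length_reverse]; simp
        rwa [e, List.sum_reverse] at this

lemma redL_sorted (l : List ℕ) (h : l.Pairwise (· < ·)) : redL l = List.range' 1 l.length := by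
  induction l with
  | nil => rfl
  | cons x t ih =>
    rw [List.pairwise_cons] at h
    have ih' := ih h.2
    have e : redL (x :: t) = 1 :: (redL t).map (1 + ·) := by
      unfold redL
      rw [List.map_cons, List.map_map]
      congr 1
      · simp only [List.countP_cons, lt_irrefl, decide_false]
        have : t.countP (fun y => decide (y < x)) = 0 := by
          rw [List.countP_eq_zero]
          intro y hy
          have := h.1 y hy
          simp; omega
        rw [this]; simp
      · refine List.map_congr_left fun y hy => ?_
        have := h.1 y hy
        simp [this]
        omega
    rw [e, ih', List.map_add_range', List.length_cons, List.range'_succ]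

lemma asc_lt (w : List ℕ) (u v : ℕ) (h : ∀ p, u ≤ p → p + 1 < v → Aw w p) (x y : ℕ) (hx : u ≤ x)
    (hxy : x < y) (hy : y < v) : w.getD x 0 < w.getD y 0 := by
  obtain ⟨m, rfl⟩ : ∃ m, y = x + 1 + m := ⟨y - x - 1, by omega⟩
  induction m with
  | zero => exact h x hx hy
  | succ m ih => exact (ih (by omega) (by omega)).trans (h (x + 1 + m) (by omega) (by omega))

lemma redL_slice (w : List ℕ) (a b : ℕ) (hb : b ≤ w.length) (hab : a ≤ b)
    (h : ∀ p, a ≤ p → p + 1 < b → Aw w p) :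
    redL ((w.drop a).take (b - a)) = List.range' 1 (b - a) := by
  have hl : ((w.drop a).take (b - a)).length = b - a := by simp; omega
  rw [redL_sorted, hl]
  rw [List.pairwise_iff_getElem]
  intro i j hi hj hij
  rw [← List.getD_eq_getElem _ 0 hi, ← List.getD_eq_getElem _ 0 hj]
  rw [hl] at hi hj
  rw [getD_slice _ _ _ _ hi, getD_slice _ _ _ _ hj]
  exact asc_lt w a b h _ _ (by omega) (by omega) (by omega)

lemma Mw_min (Γ : Set (List ℕ)) (hΓ : ∀ τ ∈ Γ, τ.head? = some 1) (w : List ℕ) (hw : w.Nodup)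
    (a b x : ℕ) (hM : Mw Γ w a b) (hx : a < x) (hxb : x < b) : w.getD a 0 < w.getD x 0 := by
  obtain ⟨h1, h2, h3⟩ := hM
  have h4 := hΓ _ h3
  by_contra hcon
  have hne : w.getD a 0 ≠ w.getD x 0 := fun h => by
    have := getD_inj hw (by omega) (by omega) h
    omega
  have hl : ((w.drop a).take (b - a)).length = b - a := by simp; omega
  have g0 := getD_slice w a (b - a) 0 (by omega)
  have g1 := getD_slice w a (b - a) (x - a) (by omega)
  rw [List.getD_eq_getElem _ _ (by omega)] at g0 g1
  rw [show a + (x - a) = x by omega] at g1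
  rw [add_zero] at g0
  have hmem : w.getD x 0 ∈ (w.drop a).take (b - a) := by rw [← g1]; exact List.getElem_mem _
  unfold redL at h4
  rw [List.head?_map, List.head?_eq_getElem?, List.getElem?_eq_getElem (by omega), g0] at h4
  simp only [Option.map_some, Option.some.injEq, Nat.add_eq_right, List.countP_eq_zero] at h4
  have := h4 _ hmem
  simp only [decide_eq_true_eq] at this
  omega

lemma MI_iff (Γ : Set (List ℕ)) (w : List ℕ) (p q : ℕ) (hq : q ≤ w.length) :
    MI (Mw Γ w) p q ↔ ∃ a j : ℕ, 1 ≤ j ∧ p ≤ a ∧ a + j + 1 ≤ q ∧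
      redL ((w.drop a).take (j + 1)) ∈ Γ := by
  unfold MI Mw
  constructor
  · rintro ⟨a, b, h1, h2, h3, h4, h5⟩
    refine ⟨a, b - a - 1, by omega, h1, by omega, ?_⟩
    rwa [show b - a - 1 + 1 = b - a by omega]
  · rintro ⟨a, j, h1, h2, h3, h4⟩
    refine ⟨a, a + j + 1, h2, h3, by omega, by omega, ?_⟩
    rwa [show a + j + 1 - a = j + 1 by omega]

lemma V_fixed (Γ : Set (List ℕ)) (hΓ : ∀ τ ∈ Γ, τ.head? = some 1) (n : ℕ) (c : Composition n)
    (w : List ℕ) (hw : w.Nodup) (hl : w.length = n) :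
    V (Aw w) (Mw Γ w) c.blocks.reverse ↔ FixedPt Γ n c w ∧
      ∀ k : ℕ, 1 ≤ k → List.range' 1 (k + 1) ∈ Γ → ∀ b ∈ c.blocks, b ≤ k := by
  rw [V_iff]
  have hmono : ∀ i j, i ≤ j → c.sizeUpTo i ≤ c.sizeUpTo j := fun i j h => c.monotone_sizeUpTo h
  have hlen : c.sizeUpTo c.length = n := c.sizeUpTo_length
  have hle : ∀ i, c.sizeUpTo i ≤ n := c.sizeUpTo_le
  have hsucc : ∀ i (h : i < c.length), c.sizeUpTo (i + 1) = c.sizeUpTo i + c.blocks[i] :=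
    fun i h => c.sizeUpTo_succ h
  have hpos : ∀ i (h : i < c.length), 1 ≤ c.blocks[i] := fun i h => c.blocks_pos (by simp)
  change (_ ∧ (∀ i < c.length, ∀ p, c.sizeUpTo i ≤ p → p + 1 < c.sizeUpTo (i + 1) → Aw w p) ∧
    (∀ i < c.length, ¬ MI (Mw Γ w) (c.sizeUpTo i) (c.sizeUpTo (i + 1))) ∧
    (∀ i, i + 1 < c.length → Aw w (c.sizeUpTo (i + 1) - 1) ∨
      MI (Mw Γ w) (c.sizeUpTo i) (c.sizeUpTo (i + 2)))) ↔ _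
  have hlt : ∀ i, i + 1 < c.length → 1 ≤ c.sizeUpTo (i + 1) ∧ c.sizeUpTo (i + 1) < n := by
    intro i hi
    have e1 := hsucc i (by omega)
    have e2 := hsucc (i + 1) hi
    have e3 := hpos i (by omega)
    have e4 := hpos (i + 1) hi
    have e5 := hle (i + 1 + 1)
    omega
  unfold FixedPt
  constructor
  · rintro ⟨h1, h2, h3, h4⟩
    refine ⟨⟨?_, ?_, ?_⟩, ?_⟩
    · intro p hp hnb
      have i1 := c.sizeUpTo_index_le ⟨p, by omega⟩
      have i2 := c.lt_sizeUpTo_index_succ ⟨p, by omega⟩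
      have i3 := (c.index ⟨p, by omega⟩).2
      simp only [Fin.val_succ] at i1 i2
      refine h2 _ i3 p i1 ?_
      by_contra hcon
      apply hnb
      refine ⟨(c.index ⟨p, by omega⟩ : ℕ) + 1, ?_, by omega⟩
      by_contra hcon2
      have : (c.index ⟨p, by omega⟩ : ℕ) + 1 = c.length := by omega
      rw [this] at i2 hcon
      omega
    · intro i hi
      have e1 := hsucc i (by omega)
      have e3 := hpos i (by omega)
      have hstart : ∀ x, c.sizeUpTo i ≤ x → x < c.sizeUpTo (i + 1) →
          w.getD (c.sizeUpTo i) 0 ≤ w.getD x 0 := by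
        intro x hx hx'
        rcases Nat.eq_or_lt_of_le hx with h | h
        · rw [h]
        · exact (asc_lt w _ _ (h2 i (by omega)) _ _ le_rfl h hx').le
      rcases h4 i hi with h | ⟨a, b, ha, hb, hm⟩
      · refine lt_of_le_of_lt (hstart (c.sizeUpTo (i + 1) - 1) (by omega) (by omega)) ?_
        unfold Aw at h
        rwa [show c.sizeUpTo (i + 1) - 1 + 1 = c.sizeUpTo (i + 1) by omega] at h
      · have g1 : a < c.sizeUpTo (i + 1) := by
          by_contra hcon
          exact h3 (i + 1) hi ⟨a, b, by omega, hb, hm⟩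
        have g2 : c.sizeUpTo (i + 1) < b := by
          by_contra hcon
          exact h3 i (by omega) ⟨a, b, ha, by omega, hm⟩
        exact lt_of_le_of_lt (hstart a ha g1) (Mw_min Γ hΓ w hw a b _ hm g1 g2)
    · intro i hi hd
      have := hlt i hi
      rw [← MI_iff _ _ _ _ (by rw [hl]; exact hle _)]
      refine (h4 i hi).resolve_left ?_
      rw [not_Aw hw (by omega), show c.sizeUpTo (i + 1) - 1 + 1 = c.sizeUpTo (i + 1) by omega]
      exact hd
    · intro k hk hmem b hb
      obtain ⟨i, hi, rfl⟩ := List.getElem_of_mem hb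
      have hi' : i < c.length := hi
      by_contra hcon
      have e1 := hsucc i hi'
      have e2 := hle (i + 1)
      refine h3 i hi' ⟨c.sizeUpTo i, c.sizeUpTo i + k + 1, le_rfl, by omega, by omega, by omega, ?_⟩
      rw [redL_slice w _ _ (by omega) (by omega)
        (fun p hp hp' => h2 i hi' p hp (by omega)),
        show c.sizeUpTo i + k + 1 - c.sizeUpTo i = k + 1 by omega]
      exact hmem
  · rintro ⟨⟨h1, h2, h3⟩, h4⟩
    have hint : ∀ i < c.length, ∀ p, c.sizeUpTo i ≤ p → p + 1 < c.sizeUpTo (i + 1) → Aw w p := by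
      intro i hi p hp hp'
      refine h1 p ?_ ?_
      · have := hle (i + 1)
        omega
      · rintro ⟨i', hi', he⟩
        rcases Nat.lt_or_ge i i' with h | h
        · have := hmono (i + 1) i' h
          omega
        · have := hmono i' i h
          omega
    refine ⟨fun b hb => c.blocks_pos hb, hint, ?_, ?_⟩
    · rintro i hi ⟨a, b, ha, hb, hm1, hm2, hm3⟩
      rw [redL_slice w a b hm2 (by omega)
        (fun p hp hp' => hint i hi p (by omega) (by omega))] at hm3
      have e1 := hsucc i hi
      have := h4 (b - a - 1) (by omega) (by rwa [show b - a - 1 + 1 = b - a by omega])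
        c.blocks[i] (by simp)
      omega
    · intro i hi
      have := hlt i hi
      by_cases hA : Aw w (c.sizeUpTo (i + 1) - 1)
      · exact Or.inl hA
      · right
        rw [not_Aw hw (by omega), show c.sizeUpTo (i + 1) - 1 + 1 = c.sizeUpTo (i + 1) by omega]
          at hA
        rw [MI_iff _ _ _ _ (by rw [hl]; exact hle _)]
        exact h3 i hi hA

end GM

open scoped Classical in
theorem stmt0 (Γ : Set (List ℕ)) (hfin : Γ.Finite)
    (hΓ : ∀ τ ∈ Γ, τ.Perm (List.range' 1 τ.length) ∧ τ.head? = some 1 ∧ desL τ ≤ 1)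
    (U : ℤ → Polynomial ℚ)
    (hUneg : ∀ m : ℤ, m < 0 → U m = 0)
    (hU0 : U 0 = 1)
    (hUrec : ∀ n : ℕ, 1 ≤ n →
      ∑ k ∈ Finset.range (n + 1), (n.choose k : ℚ) • (U (k : ℤ) * NMpoly Γ (n - k)) = 0) :
    ∀ n : ℕ, 1 ≤ n →
      U (n : ℤ) = ∑ c : Composition n,
        ∑ σ ∈ ((List.range' 1 n).permutations.toFinset.filter
          (fun σ => FixedPt Γ n c σ ∧
            ∀ k : ℕ, 1 ≤ k → List.range' 1 (k + 1) ∈ Γ → ∀ b ∈ c.blocks, b ≤ k)),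
          (-X : Polynomial ℚ) ^ c.length := by
  have hd : ∀ τ ∈ Γ, desL τ ≤ 1 := fun τ h => (hΓ τ h).2.2
  have hh : ∀ τ ∈ Γ, τ.head? = some 1 := fun τ h => (hΓ τ h).2.1
  intro n _
  have key := GM.uniq (NMpoly Γ) (fun k => ∑ u ∈ GM.PS (Finset.Icc 1 k), GM.fL Γ k u)
    (fun k => U (k : ℤ)) (by simp [NMpoly]) ?_ ?_ hUrec n
  · refine key.trans ?_
    simp only [GM.fL, GM.fA]
    rw [Finset.sum_comm]
    refine Finset.sum_congr rfl fun c _ => ?_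
    rw [Finset.sum_filter, GM.range'_PS]
    refine Finset.sum_congr rfl fun w hw => ?_
    refine if_congr (GM.V_fixed Γ hh n c w (GM.mem_PS.1 hw).1 ?_) rfl rfl
    rw [GM.PS_length hw]; simp
  · have : GM.PS (Finset.Icc 1 0) = {[]} := by
      ext w
      rw [GM.mem_PS]
      simp
      rintro rfl
      simp
    simp only [this, Finset.sum_singleton, GM.fL, GM.fA, Nat.cast_zero, hU0]
    have e : ∀ c : Composition 0, c.blocks = [] := by
      intro c
      apply List.eq_nil_of_length_eq_zero
      have := c.length_le
      exact Nat.le_zero.1 this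
    rw [Fintype.sum_eq_single (default : Composition 0)
      (fun c hc => absurd (Composition.ext ((e _).trans (e _).symm)) hc)]
    simp [e, GM.V, Composition.length]
  · intro m hm
    rw [← GM.conv_zero Γ hd m hm]
    simp only [GM.sum_gL]
end

section
/- Let Γ = {1324, 123}. Then U_{Γ,1}(y) = −y, and for all n ≥ 2, U_{Γ,n}(y) = −y·U_{Γ,n−1}(y) − y·U_{Γ,n−2}(y) + Σ_{k=2}^{⌊n/2⌋} (−y)^k · C_{k−1} · U_{Γ,n−2k}(y), where C_m = binom(2m,m)/(m+1) is the m-th Catalan number. -/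
open Polynomial

/-- Weighted count of completions of a partial non-nesting structure. -/
noncomputable def Wt : ℕ → ℕ → ℚ[X]
  | 0, 0 => 1
  | 0, _ + 1 => 0
  | n + 1, 0 => -X * Wt n 0 + Wt n 1
  | n + 1, h + 1 => -X * Wt n h + Wt n (h + 2)

noncomputable def Gs : PowerSeries ℚ[X] :=
  PowerSeries.expand 2 (by norm_num) (PowerSeries.rescale (-X : ℚ[X])
    (PowerSeries.map (Nat.castRingHom ℚ[X]) PowerSeries.catalanSeries))

noncomputable def As : PowerSeries ℚ[X] :=
  PowerSeries.C (-X : ℚ[X]) * PowerSeries.X * Gs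

theorem Gs_eq : Gs = Gs ^ 2 * (PowerSeries.C (-X : ℚ[X]) * PowerSeries.X ^ 2) + 1 := by
  have h := PowerSeries.catalanSeries_sq_mul_X_add_one
  have h2 := congrArg (fun s => PowerSeries.expand 2 (by norm_num) (PowerSeries.rescale (-X : ℚ[X])
    (PowerSeries.map (Nat.castRingHom ℚ[X]) s))) h
  simp only [map_add, map_mul, map_pow, map_one, PowerSeries.map_X, PowerSeries.rescale_X,
    PowerSeries.expand_X, PowerSeries.expand_C] at h2
  exact h2.symm

theorem As_eq : As = PowerSeries.X * (PowerSeries.C (-X : ℚ[X]) + As ^ 2) := by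
  have h := Gs_eq
  unfold As
  linear_combination (PowerSeries.C (-X : ℚ[X]) * PowerSeries.X) * h

theorem As_coeff_odd (m : ℕ) : PowerSeries.coeff (2 * m + 1) As = (-X) ^ (m + 1) * (catalan m : ℚ[X]) := by
  unfold As Gs
  rw [mul_assoc, PowerSeries.coeff_C_mul, mul_comm PowerSeries.X, PowerSeries.coeff_succ_mul_X,
    PowerSeries.coeff_expand_mul]
  simp [PowerSeries.coeff_rescale]
  ring

theorem As_coeff_even (m : ℕ) (hm : 2 ∣ m) : PowerSeries.coeff m As = 0 := by
  unfold As Gs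
  rw [mul_assoc, PowerSeries.coeff_C_mul, mul_comm PowerSeries.X]
  cases m with
  | zero => simp
  | succ k =>
    rw [PowerSeries.coeff_succ_mul_X, PowerSeries.coeff_expand_of_not_dvd, mul_zero]
    omega

noncomputable def Ws (h : ℕ) : PowerSeries ℚ[X] := PowerSeries.mk (fun n => Wt n h)

theorem Ws_succ (h : ℕ) : Ws (h + 1) = PowerSeries.X * (PowerSeries.C (-X : ℚ[X]) * Ws h + Ws (h + 2)) := by
  ext1 n
  cases n with
  | zero => simp [Ws, Wt]
  | succ n =>
    rw [mul_comm PowerSeries.X, PowerSeries.coeff_succ_mul_X, map_add, PowerSeries.coeff_C_mul]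
    simp [Ws, Wt]

theorem Ws_rec (h : ℕ) : Ws (h + 1) = As * Ws h := by
  have key : ∀ k h, PowerSeries.X ^ k ∣ Ws (h + 1) - As * Ws h := by
    intro k
    induction k with
    | zero => intro h; simp
    | succ k ih =>
      intro h
      have e : Ws (h + 1) - As * Ws h =
          PowerSeries.X * ((Ws (h + 2) - As * Ws (h + 1)) + As * (Ws (h + 1) - As * Ws h)) := by
        linear_combination Ws_succ h - Ws h * As_eq
      rw [e, pow_succ, mul_comm _ PowerSeries.X]
      exact mul_dvd_mul_left _ (dvd_add (ih (h + 1)) (Dvd.dvd.mul_left (ih h) _))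
  have : Ws (h + 1) - As * Ws h = 0 := by
    ext1 n
    rw [PowerSeries.X_pow_dvd_iff.1 (key (n + 1) h) n (by omega), map_zero]
  exact sub_eq_zero.1 this

theorem Wt_one (n : ℕ) : Wt n 1 = ∑ p ∈ Finset.HasAntidiagonal.antidiagonal n, PowerSeries.coeff p.1 As * Wt p.2 0 := by
  have h := congrArg (PowerSeries.coeff n) (Ws_rec 0)
  rw [PowerSeries.coeff_mul] at h
  simpa [Ws] using h

theorem Wt_rec (n : ℕ) (hn : 2 ≤ n) : Wt n 0 = -X * Wt (n - 1) 0 - X * Wt (n - 2) 0 +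
    ∑ k ∈ Finset.Icc 2 (n / 2), (-X) ^ k * (catalan (k - 1) : ℚ[X]) * Wt (n - 2 * k) 0 := by
  obtain ⟨n, rfl⟩ : ∃ m, n = m + 1 := ⟨n - 1, by omega⟩
  have h1 : Wt n 1 = ∑ k ∈ Finset.Icc 1 ((n + 1) / 2),
      (-X) ^ k * (catalan (k - 1) : ℚ[X]) * Wt (n + 1 - 2 * k) 0 := by
    rw [Wt_one]
    symm
    apply Finset.sum_of_injOn (fun k : ℕ => (2 * k - 1, n + 1 - 2 * k))
    · intro a ha b hb hab
      simp at ha hb hab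
      omega
    · intro a ha
      simp at ha ⊢
      omega
    · intro p hp hp2
      rw [As_coeff_even, zero_mul]
      by_contra hc
      apply hp2
      simp at hp
      refine ⟨(p.1 + 1) / 2, ?_, ?_⟩
      · simp; omega
      · ext <;> simp <;> omega
    · intro k hk
      simp at hk
      have := As_coeff_odd (k - 1)
      rw [show 2 * (k - 1) + 1 = 2 * k - 1 by omega, show k - 1 + 1 = k by omega] at this
      simp only [this]
  rw [Wt, h1, ← Finset.add_sum_Ioc_eq_sum_Icc (by omega : 1 ≤ (n + 1) / 2),
    show Finset.Ioc 1 ((n + 1) / 2) = Finset.Icc 2 ((n + 1) / 2) from by ext; simp; omega]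
  simp
  ring

/-- The cells of a brick: `(a, a)` is a singleton brick, `(a, b)` with `a < b` a brick of size two. -/
def cells (p : ℕ × ℕ) : List ℕ := if p.1 = p.2 then [p.1] else [p.1, p.2]

def fl (L : List (ℕ × ℕ)) : List ℕ := L.flatMap cells

def Rb (p q : ℕ × ℕ) : Prop := p.1 < q.1 ∧ p.2 < q.2

def IsB (S : Finset ℕ) (L : List (ℕ × ℕ)) : Prop :=
  (∀ p ∈ L, p.1 ≤ p.2) ∧ (fl L).Nodup ∧ ∀ x, x ∈ fl L ↔ x ∈ S

@[simp] theorem fl_nil : fl [] = [] := rfl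
@[simp] theorem fl_cons (p : ℕ × ℕ) (L) : fl (p :: L) = cells p ++ fl L := by simp [fl]
@[simp] theorem fl_append (L M) : fl (L ++ M) = fl L ++ fl M := by simp [fl]

theorem mem_cells (p : ℕ × ℕ) (x : ℕ) : x ∈ cells p ↔ x = p.1 ∨ x = p.2 := by
  unfold cells; split_ifs with h <;> simp [h]

theorem mem_fl (L) (x : ℕ) : x ∈ fl L ↔ ∃ p ∈ L, x = p.1 ∨ x = p.2 := by
  simp [fl, mem_cells]

theorem length_le_fl (L) : L.length ≤ (fl L).length := by
  induction L with
  | nil => simp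
  | cons p L ih =>
    have : 1 ≤ (cells p).length := by unfold cells; split_ifs <;> simp
    simp; omega

theorem nodup_cells (p) : (cells p).Nodup := by
  unfold cells; split_ifs with h <;> simp [h]

/-- Lists of length at most `n` with entries in `A`. -/
def allL (A : Finset (ℕ × ℕ)) : ℕ → Finset (List (ℕ × ℕ))
  | 0 => {[]}
  | n + 1 => insert [] (Finset.image₂ List.cons A (allL A n))

theorem mem_allL (A : Finset (ℕ × ℕ)) (n : ℕ) (L : List (ℕ × ℕ)) (h : L.length ≤ n)
    (hA : ∀ p ∈ L, p ∈ A) : L ∈ allL A n := by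
  induction n generalizing L with
  | zero => simp at h; simp [allL, h]
  | succ n ih =>
    cases L with
    | nil => simp [allL]
    | cons p L =>
      simp only [allL, Finset.mem_insert, Finset.mem_image₂]
      right
      exact ⟨p, hA p (by simp), L, ih L (by simpa using h) (fun q hq => hA q (by simp [hq])), rfl⟩

open scoped Classical in
noncomputable def BL (S : Finset ℕ) : Finset (List (ℕ × ℕ)) :=
  (allL (S ×ˢ S) S.card).filter (IsB S)

theorem IsB.fl_perm {S L} (h : IsB S L) : (fl L).toFinset = S := by
  ext x; simp [h.2.2]

theorem mem_BL {S L} : L ∈ BL S ↔ IsB S L := by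
  classical
  unfold BL
  rw [Finset.mem_filter]
  refine ⟨fun h => h.2, fun h => ⟨?_, h⟩⟩
  apply mem_allL
  · have := length_le_fl L
    have h2 := List.toFinset_card_of_nodup h.2.1
    rw [h.fl_perm] at h2
    omega
  · intro p hp
    rw [Finset.mem_product]
    exact ⟨(h.2.2 _).1 ((mem_fl _ _).2 ⟨p, hp, Or.inl rfl⟩),
      (h.2.2 _).1 ((mem_fl _ _).2 ⟨p, hp, Or.inr rfl⟩)⟩

open scoped Classical in
noncomputable def fS (S : Finset ℕ) : ℚ[X] :=
  ∑ L ∈ (BL S).filter (List.IsChain (fun p q => ¬ Rb p q)), X ^ L.length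

open scoped Classical in
noncomputable def uS (S : Finset ℕ) : ℚ[X] :=
  ∑ L ∈ (BL S).filter (List.IsChain Rb), (-X) ^ L.length

theorem split_IsB {S L M} (h : IsB S (L ++ M)) : IsB (fl L).toFinset L ∧ IsB (S \ (fl L).toFinset) M ∧ (fl L).toFinset ⊆ S := by
  obtain ⟨h1, h2, h3⟩ := h
  rw [fl_append, List.nodup_append'] at h2
  simp only [fl_append, List.mem_append] at h3 h1
  refine ⟨⟨fun p hp => h1 p (Or.inl hp), h2.1, fun x => by simp⟩,
    ⟨fun p hp => h1 p (Or.inr hp), h2.2.1, fun x => ?_⟩, ?_⟩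
  · have := h3 x
    have h4 := @h2.2.2 x
    simp
    tauto
  · intro x hx
    rw [← h3]; left; simpa using hx

theorem join_IsB {S T L M} (hT : T ⊆ S) (hL : IsB T L) (hM : IsB (S \ T) M) : IsB S (L ++ M) := by
  obtain ⟨h1, h2, h3⟩ := hL
  obtain ⟨k1, k2, k3⟩ := hM
  refine ⟨fun p hp => ?_, ?_, fun x => ?_⟩
  · rcases List.mem_append.1 hp with h | h
    · exact h1 p h
    · exact k1 p h
  · rw [fl_append, List.nodup_append']
    refine ⟨h2, k2, fun x hx hx2 => ?_⟩
    rw [h3] at hx; rw [k3] at hx2; simp at hx2; tauto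
  · have := @hT x
    simp [h3, k3]; tauto

open scoped Classical in
theorem alt_sum_aux (R : ℕ × ℕ → ℕ × ℕ → Prop) (b : ℕ × ℕ) (L : List (ℕ × ℕ)) :
    ∑ i ∈ Finset.range (L.length + 1), (if (List.IsChain R (b :: L.take i) ∧
      List.IsChain (fun p q => ¬ R p q) (L.drop i)) then (-1 : ℚ[X]) ^ i else 0) =
    if List.IsChain (fun p q => ¬ R p q) (b :: L) then 1 else 0 := by
  induction L generalizing b with
  | nil => simp
  | cons c L ih =>
    have ih := ih c
    rw [List.length_cons, Finset.sum_range_succ']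
    have : ∀ i, (if (List.IsChain R (b :: (c :: L).take (i + 1)) ∧
      List.IsChain (fun p q => ¬ R p q) ((c :: L).drop (i + 1))) then (-1 : ℚ[X]) ^ (i + 1) else 0)
      = (if R b c then -1 else 0) * (if (List.IsChain R (c :: L.take i) ∧
      List.IsChain (fun p q => ¬ R p q) (L.drop i)) then (-1 : ℚ[X]) ^ i else 0) := by
      intro i
      simp only [List.take_succ_cons, List.drop_succ_cons, List.isChain_cons_cons]
      by_cases h : R b c <;> simp [h, pow_succ]
    rw [Finset.sum_congr rfl (fun i _ => this i), ← Finset.mul_sum, ih]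
    by_cases h : R b c <;> by_cases h2 : List.IsChain (fun p q => ¬ R p q) (c :: L) <;>
      simp [h, h2]

open scoped Classical in
theorem alt_sum (R : ℕ × ℕ → ℕ × ℕ → Prop) (L : List (ℕ × ℕ)) (hL : L ≠ []) :
    ∑ i ∈ Finset.range (L.length + 1), (if (List.IsChain R (L.take i) ∧
      List.IsChain (fun p q => ¬ R p q) (L.drop i)) then (-1 : ℚ[X]) ^ i else 0) = 0 := by
  cases L with
  | nil => simp at hL
  | cons c L =>
    rw [List.length_cons, Finset.sum_range_succ']
    have h := alt_sum_aux R c L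
    have : ∀ i, (if (List.IsChain R ((c :: L).take (i + 1)) ∧
      List.IsChain (fun p q => ¬ R p q) ((c :: L).drop (i + 1))) then (-1 : ℚ[X]) ^ (i + 1) else 0)
      = (-1) * (if (List.IsChain R (c :: L.take i) ∧
      List.IsChain (fun p q => ¬ R p q) (L.drop i)) then (-1 : ℚ[X]) ^ i else 0) := by
      intro i
      simp [pow_succ]
    rw [Finset.sum_congr rfl (fun i _ => this i), ← Finset.mul_sum, h]
    by_cases h2 : List.IsChain (fun p q => ¬ R p q) (c :: L) <;> simp [h2]

theorem uf_sum (S : Finset ℕ) (hS : S.Nonempty) : ∑ T ∈ S.powerset, uS T * fS (S \ T) = 0 := by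
  classical
  have e1 : ∑ T ∈ S.powerset, uS T * fS (S \ T) =
      ∑ z ∈ S.powerset.sigma (fun T => (BL T).filter (List.IsChain Rb) ×ˢ
        (BL (S \ T)).filter (List.IsChain (fun p q => ¬ Rb p q))),
        (-X) ^ z.2.1.length * X ^ z.2.2.length := by
    rw [Finset.sum_sigma]
    refine Finset.sum_congr rfl fun T _ => ?_
    rw [Finset.sum_product, uS, fS, Finset.sum_mul_sum]
  have e2 : ∑ z ∈ S.powerset.sigma (fun T => (BL T).filter (List.IsChain Rb) ×ˢ
        (BL (S \ T)).filter (List.IsChain (fun p q => ¬ Rb p q))),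
        ((-X) ^ z.2.1.length * X ^ z.2.2.length : ℚ[X]) =
      ∑ z ∈ ((BL S).sigma (fun L => Finset.range (L.length + 1))).filter
        (fun z => List.IsChain Rb (z.1.take z.2) ∧
          List.IsChain (fun p q => ¬ Rb p q) (z.1.drop z.2)),
        X ^ z.1.length * (-1 : ℚ[X]) ^ z.2 := by
    refine Finset.sum_bij' (fun z _ => ⟨z.2.1 ++ z.2.2, z.2.1.length⟩)
      (fun z _ => ⟨(fl (z.1.take z.2)).toFinset, (z.1.take z.2, z.1.drop z.2)⟩) ?_ ?_ ?_ ?_ ?_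
    · rintro ⟨T, L, M⟩ h
      simp only [Finset.mem_sigma, Finset.mem_powerset, Finset.mem_product, Finset.mem_filter,
        mem_BL] at h
      obtain ⟨hT, ⟨hL, hL2⟩, hM, hM2⟩ := h
      simp only [Finset.mem_sigma, Finset.mem_filter, mem_BL, Finset.mem_range, List.take_left,
        List.drop_left]
      refine ⟨⟨join_IsB hT hL hM, ?_⟩, hL2, hM2⟩
      simp
    · rintro ⟨L, i⟩ h
      simp only [Finset.mem_sigma, Finset.mem_filter, mem_BL, Finset.mem_range] at h
      obtain ⟨⟨h1, h2⟩, h3, h4⟩ := h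
      simp only [Finset.mem_sigma, Finset.mem_powerset, Finset.mem_product, Finset.mem_filter,
        mem_BL]
      rw [← List.take_append_drop i L] at h1
      obtain ⟨a, b, c⟩ := split_IsB h1
      exact ⟨c, ⟨a, h3⟩, b, h4⟩
    · rintro ⟨T, L, M⟩ h
      simp only [Finset.mem_sigma, Finset.mem_powerset, Finset.mem_product, Finset.mem_filter,
        mem_BL] at h
      obtain ⟨hT, ⟨hL, hL2⟩, hM, hM2⟩ := h
      simp [hL.fl_perm]
    · rintro ⟨L, i⟩ h
      simp only [Finset.mem_sigma, Finset.mem_filter, mem_BL, Finset.mem_range] at h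
      simp
      omega
    · rintro ⟨T, L, M⟩ h
      simp only [List.length_append]
      rw [neg_pow, pow_add]; ring
  rw [e1, e2, Finset.sum_filter, Finset.sum_sigma]
  refine Finset.sum_eq_zero fun L hL => ?_
  have hne : L ≠ [] := by
    rintro rfl
    rw [mem_BL] at hL
    obtain ⟨x, hx⟩ := hS
    have := (hL.2.2 x).2 hx
    simp at this
  have h := alt_sum Rb L hne
  have h2 := congrArg (fun z => (X : ℚ[X]) ^ L.length * z) h
  simp only [Finset.mul_sum, mul_zero, mul_ite] at h2
  exact h2

theorem IsB_cons {S : Finset ℕ} {p L} : IsB S (p :: L) ↔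
    p.1 ≤ p.2 ∧ p.1 ∈ S ∧ p.2 ∈ S ∧ IsB ((S.erase p.1).erase p.2) L := by
  unfold IsB
  simp only [List.mem_cons, forall_eq_or_imp, fl_cons, List.nodup_append', nodup_cells, true_and,
    List.mem_append, mem_cells, Finset.mem_erase, List.disjoint_left]
  constructor
  · rintro ⟨⟨h1, h2⟩, ⟨h3, h4⟩, h5⟩
    refine ⟨h1, (h5 _).1 (by simp), (h5 _).1 (by simp), h2, h3, fun x => ?_⟩
    have := h5 x
    have h6 : x ∈ fl L → x ≠ p.1 ∧ x ≠ p.2 := fun hx =>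
      ⟨fun e => h4.1 (e ▸ hx), fun e => h4.2 _ e hx⟩
    tauto
  · rintro ⟨h1, h2, h3, h4, h5, h6⟩
    refine ⟨⟨h1, h4⟩, ⟨h5, fun hx => ?_, fun x hx hx2 => ?_⟩, fun x => ?_⟩
    · rw [h6] at hx; tauto
    · rw [h6] at hx2; tauto
    · rw [h6]
      by_cases e1 : x = p.1
      · subst e1; tauto
      · by_cases e2 : x = p.2
        · subst e2; tauto
        · tauto

open scoped Classical in
noncomputable def ES (Q S : Finset ℕ) : Finset (List (ℕ × ℕ)) :=
  (BL (Q ∪ S)).filter (fun L => List.Pairwise Rb L ∧ ∀ p ∈ L, p.2 ∉ Q)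

theorem mem_ES {Q S L} : L ∈ ES Q S ↔ IsB (Q ∪ S) L ∧ List.Pairwise Rb L ∧ ∀ p ∈ L, p.2 ∉ Q := by
  classical
  unfold ES
  rw [Finset.mem_filter, mem_BL]

theorem IsB.mem1 {S L p} (h : IsB S L) (hp : p ∈ L) : p.1 ∈ S :=
  (h.2.2 _).1 ((mem_fl _ _).2 ⟨p, hp, Or.inl rfl⟩)

theorem IsB.mem2 {S L p} (h : IsB S L) (hp : p ∈ L) : p.2 ∈ S :=
  (h.2.2 _).1 ((mem_fl _ _).2 ⟨p, hp, Or.inr rfl⟩)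

theorem ES_cons {Q S : Finset ℕ} {s m : ℕ} (hQS : ∀ q ∈ Q, ∀ x ∈ S, q < x) (hs : s ∈ S)
    (hs2 : ∀ x ∈ S, s ≤ x) (hm : m ∈ insert s Q) (hm2 : ∀ x ∈ insert s Q, m ≤ x) (L) :
    (L ∈ ES Q S ∧ ∃ p ∈ L, p.2 = s) ↔ ∃ L' ∈ ES (Q.erase m) (S.erase s), L = (m, s) :: L' := by
  have hset : ((Q ∪ S).erase m).erase s = Q.erase m ∪ S.erase s := by
    ext x
    simp only [Finset.mem_erase, Finset.mem_union, Finset.mem_insert] at hm ⊢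
    constructor
    · tauto
    · rintro (⟨h1, h2⟩ | ⟨h1, h2⟩)
      · have := hQS x h2 s hs
        exact ⟨by omega, h1, Or.inl h2⟩
      · refine ⟨h1, ?_, Or.inr h2⟩
        rcases hm with hm | hm
        · omega
        · have := hQS m hm x h2
          omega
  have hms : m ≤ s := hm2 s (by simp)
  have hmem : m ∈ Q ∪ S := by
    simp only [Finset.mem_insert, Finset.mem_union] at hm ⊢
    rcases hm with rfl | hm
    · exact Or.inr hs
    · exact Or.inl hm
  constructor
  · rintro ⟨hL, p, hp, hps⟩
    rw [mem_ES] at hL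
    obtain ⟨hB, hP, hQ⟩ := hL
    cases L with
    | nil => simp at hp
    | cons q L =>
      rw [List.pairwise_cons] at hP
      have hq2 : q.2 = s := by
        rcases List.mem_cons.1 hp with rfl | hp'
        · exact hps
        · have h1 := (hP.1 p hp').2
          have h2 := hB.mem2 (List.mem_cons_self (a := q) (l := L))
          have h3 := hQ q List.mem_cons_self
          rcases Finset.mem_union.1 h2 with h | h
          · exact absurd h h3
          · have := hs2 _ h; omega
      have hle : q.1 ≤ q.2 := hB.1 q List.mem_cons_self
      have hq1 : q.1 = m := by
        apply le_antisymm
        · have : m ∈ fl (q :: L) := (hB.2.2 m).2 hmem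
          obtain ⟨r, hr, hr2⟩ := (mem_fl _ _).1 this
          have hr3 := hB.1 r hr
          rcases List.mem_cons.1 hr with rfl | hr'
          · omega
          · have := (hP.1 r hr').1
            omega
        · apply hm2
          rw [Finset.mem_insert]
          rcases Finset.mem_union.1 (hB.mem1 (List.mem_cons_self (a := q) (l := L))) with h | h
          · exact Or.inr h
          · have := hs2 _ h; left; omega
      have hq : q = (m, s) := Prod.ext hq1 hq2
      subst hq
      refine ⟨L, ?_, rfl⟩
      rw [mem_ES]
      have := (IsB_cons.1 hB).2.2.2
      simp only [hset] at this
      refine ⟨this, hP.2, fun p hp h => hQ p (List.mem_cons_of_mem _ hp) (Finset.mem_of_mem_erase h)⟩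
  · rintro ⟨L', hL', rfl⟩
    rw [mem_ES] at hL'
    obtain ⟨hB, hP, hQ⟩ := hL'
    refine ⟨?_, (m, s), by simp, rfl⟩
    rw [mem_ES, IsB_cons, List.pairwise_cons]
    have h2S : ∀ p ∈ L', p.2 ∈ S.erase s := by
      intro p hp
      rcases Finset.mem_union.1 (hB.mem2 hp) with h | h
      · exact absurd h (hQ p hp)
      · exact h
    refine ⟨⟨hms, hmem, by simp [hs], ?_⟩, ⟨fun p hp => ⟨?_, ?_⟩, hP⟩, ?_⟩
    · simp only [hset]; exact hB
    · rcases Finset.mem_union.1 (hB.mem1 hp) with h | h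
      · rw [Finset.mem_erase] at h
        have := hm2 p.1 (by simp [h.2])
        simp only
        omega
      · rw [Finset.mem_erase] at h
        have := hs2 p.1 h.2
        simp only
        omega
    · have h := h2S p hp
      rw [Finset.mem_erase] at h
      have := hs2 p.2 h.2
      simp only
      omega
    · intro p hp hpQ
      rcases List.mem_cons.1 hp with rfl | hp
      · have := hQS _ hpQ s hs
        simp at this
      · have h := h2S p hp
        rw [Finset.mem_erase] at h
        have := hQS _ hpQ _ h.2
        omega

theorem ES_open {Q S : Finset ℕ} {s : ℕ} (hs : s ∈ S) (L) :
    (L ∈ ES Q S ∧ ¬ ∃ p ∈ L, p.2 = s) ↔ L ∈ ES (insert s Q) (S.erase s) := by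
  have hset : insert s Q ∪ S.erase s = Q ∪ S := by
    ext x
    simp only [Finset.mem_erase, Finset.mem_union, Finset.mem_insert]
    by_cases h : x = s
    · subst h; tauto
    · tauto
  rw [mem_ES, mem_ES, hset]
  simp only [Finset.mem_insert, not_or, not_exists, not_and]
  constructor
  · rintro ⟨⟨h1, h2, h3⟩, h4⟩
    exact ⟨h1, h2, fun p hp => ⟨h4 p hp, h3 p hp⟩⟩
  · rintro ⟨h1, h2, h3⟩
    exact ⟨⟨h1, h2, fun p hp => (h3 p hp).2⟩, fun p hp => (h3 p hp).1⟩

theorem ES_sum (n : ℕ) (Q S : Finset ℕ) (hn : S.card = n) (hQS : ∀ q ∈ Q, ∀ x ∈ S, q < x) :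
    ∑ L ∈ ES Q S, (-X : ℚ[X]) ^ L.length = Wt n Q.card := by
  classical
  induction n generalizing Q S with
  | zero =>
    rw [Finset.card_eq_zero] at hn
    subst hn
    by_cases hQ : Q = ∅
    · subst hQ
      have : ES ∅ ∅ = {[]} := by
        ext L
        rw [mem_ES, Finset.mem_singleton]
        constructor
        · rintro ⟨h, -⟩
          cases L with
          | nil => rfl
          | cons p L => have := h.mem1 (List.mem_cons_self (a := p) (l := L)); simp at this
        · rintro rfl
          simp [IsB]
      rw [this]
      simp [Wt]
    · have : ES Q ∅ = ∅ := by
        rw [Finset.eq_empty_iff_forall_notMem]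
        intro L hL
        rw [mem_ES] at hL
        obtain ⟨h1, h2, h3⟩ := hL
        obtain ⟨x, hx⟩ := Finset.nonempty_iff_ne_empty.2 hQ
        obtain ⟨p, hp, -⟩ := (mem_fl _ _).1 ((h1.2.2 x).2 (by simp [hx]))
        have := h1.mem2 hp
        simp at this
        exact h3 p hp this
      rw [this]
      obtain ⟨k, hk⟩ : ∃ k, Q.card = k + 1 :=
        ⟨Q.card - 1, by have := Finset.card_pos.2 (Finset.nonempty_iff_ne_empty.2 hQ); omega⟩
      rw [hk]
      simp [Wt]
  | succ n ih =>
    have hne : S.Nonempty := by rw [← Finset.card_pos]; omega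
    obtain ⟨s, hs, hs2⟩ : ∃ s ∈ S, ∀ x ∈ S, s ≤ x :=
      ⟨S.min' hne, S.min'_mem hne, fun x hx => S.min'_le x hx⟩
    obtain ⟨m, hm, hm2⟩ : ∃ m ∈ insert s Q, ∀ x ∈ insert s Q, m ≤ x :=
      ⟨(insert s Q).min' (by simp), Finset.min'_mem _ _, fun x hx => Finset.min'_le _ x hx⟩
    have hsQ : s ∉ Q := fun h => lt_irrefl _ (hQS s h s hs)
    have hcard : (S.erase s).card = n := by rw [Finset.card_erase_of_mem hs]; omega
    rw [← Finset.sum_filter_add_sum_filter_not (ES Q S) (fun L => ∃ p ∈ L, p.2 = s)]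
    have e1 : (ES Q S).filter (fun L => ¬ ∃ p ∈ L, p.2 = s) = ES (insert s Q) (S.erase s) := by
      ext L
      rw [Finset.mem_filter, ES_open hs]
    have e2 : (ES Q S).filter (fun L => ∃ p ∈ L, p.2 = s) =
        (ES (Q.erase m) (S.erase s)).image (fun L => (m, s) :: L) := by
      ext L
      rw [Finset.mem_filter, ES_cons hQS hs hs2 hm hm2, Finset.mem_image]
      simp only [eq_comm]
    rw [e1, e2, Finset.sum_image (by intro a _ b _ h; simpa using h), ih _ _ hcard]
    swap
    · intro q hq x hx
      rw [Finset.mem_erase] at hx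
      have := hs2 x hx.2
      rcases Finset.mem_insert.1 hq with rfl | hq
      · omega
      · exact hQS q hq x hx.2
    have e3 : ∑ L ∈ ES (Q.erase m) (S.erase s), (-X : ℚ[X]) ^ ((m, s) :: L).length =
        -X * Wt n (Q.erase m).card := by
      rw [← ih _ _ hcard, Finset.mul_sum]
      · refine Finset.sum_congr rfl fun L _ => ?_
        rw [List.length_cons, pow_succ]; ring
      · intro q hq x hx
        exact hQS q (Finset.mem_of_mem_erase hq) x (Finset.mem_of_mem_erase hx)
    rw [e3, Finset.card_insert_of_notMem hsQ]
    by_cases hQ : Q = ∅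
    · subst hQ
      simp [Wt]
    · obtain ⟨x, hx⟩ := Finset.nonempty_iff_ne_empty.2 hQ
      have hmQ : m ∈ Q := by
        rcases Finset.mem_insert.1 hm with rfl | h
        · have := hm2 x (by simp [hx])
          have := hQS x hx m hs
          omega
        · exact h
      obtain ⟨k, hk⟩ : ∃ k, Q.card = k + 1 :=
        ⟨Q.card - 1, by have := Finset.card_pos.2 ⟨x, hx⟩; omega⟩
      rw [Finset.card_erase_of_mem hmQ, hk]
      simp [Wt]

instance : Trans Rb Rb Rb where
  trans h1 h2 := ⟨h1.1.trans h2.1, h1.2.trans h2.2⟩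

theorem uS_eq (S : Finset ℕ) : uS S = Wt S.card 0 := by
  classical
  have h := ES_sum S.card ∅ S rfl (by simp)
  rw [Finset.card_empty] at h
  rw [← h, uS]
  refine Finset.sum_congr ?_ fun _ _ => rfl
  ext L
  rw [mem_ES, Finset.mem_filter, mem_BL, List.isChain_iff_pairwise]
  simp

theorem fS_card (n : ℕ) : ∀ S T : Finset ℕ, S.card = n → T.card = n → fS S = fS T := by
  induction n using Nat.strong_induction_on with
  | _ n ih =>
    -- the value of `fS` on smaller sets
    have hsm : ∀ k < n, ∀ S : Finset ℕ, S.card = k → fS S = fS (Finset.range k) :=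
      fun k hk S hS => ih k hk S _ hS (by simp)
    have key : ∀ S : Finset ℕ, S.card = n → 0 < n → fS S = - ∑ T ∈ S.powerset.erase ∅,
        (fun k => Wt k 0 * fS (Finset.range (n - k))) T.card := by
      intro S hS hn
      have h := uf_sum S (Finset.card_pos.1 (by omega))
      rw [← Finset.add_sum_erase _ _ (Finset.empty_mem_powerset S)] at h
      rw [uS_eq, Finset.card_empty, Finset.sdiff_empty] at h
      have e : ∑ T ∈ S.powerset.erase ∅, uS T * fS (S \ T) = ∑ T ∈ S.powerset.erase ∅,
        (fun k => Wt k 0 * fS (Finset.range (n - k))) T.card := by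
        refine Finset.sum_congr rfl fun T hT => ?_
        rw [Finset.mem_erase, Finset.mem_powerset] at hT
        have h1 := Finset.card_pos.2 (Finset.nonempty_iff_ne_empty.2 hT.1)
        have h2 := Finset.card_sdiff_of_subset hT.2
        rw [uS_eq, hsm (n - T.card) (by omega) (S \ T) (by omega)]
      rw [e] at h
      have hW : Wt 0 0 = 1 := by simp [Wt]
      rw [hW, one_mul] at h
      exact eq_neg_of_add_eq_zero_left h
    intro S T hS hT
    rcases Nat.eq_zero_or_pos n with rfl | hn
    · rw [Finset.card_eq_zero] at hS hT
      rw [hS, hT]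
    · rw [key S hS hn, key T hT hn]
      have e : ∀ S : Finset ℕ, S.card = n → ∑ T ∈ S.powerset.erase ∅,
          (fun k => Wt k 0 * fS (Finset.range (n - k))) T.card =
          (∑ m ∈ Finset.range (n + 1), n.choose m • (Wt m 0 * fS (Finset.range (n - m)))) -
            Wt 0 0 * fS (Finset.range n) := by
        intro S hS
        rw [eq_sub_iff_add_eq, ← hS, ← Finset.sum_powerset_apply_card (fun k => Wt k 0 * fS (Finset.range (S.card - k))),
          ← Finset.sum_erase_add _ _ (Finset.empty_mem_powerset S)]
        simp
      rw [e S hS, e T hT]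

theorem uf_rec (n : ℕ) (hn : 1 ≤ n) : ∑ k ∈ Finset.range (n + 1),
    (n.choose k : ℚ) • (Wt k 0 * fS (Finset.Icc 1 (n - k))) = 0 := by
  have h := uf_sum (Finset.Icc 1 n) ⟨1, by simp [hn]⟩
  rw [← h]
  have := Finset.sum_powerset_apply_card (fun k => Wt k 0 * fS (Finset.Icc 1 (n - k)))
    (x := Finset.Icc 1 n)
  rw [Nat.card_Icc, Nat.add_sub_cancel] at this
  rw [Finset.sum_congr rfl (g := fun k => n.choose k • (Wt k 0 * fS (Finset.Icc 1 (n - k))))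
    (fun k _ => by rw [Nat.cast_smul_eq_nsmul]), ← this]
  refine Finset.sum_congr rfl fun T hT => ?_
  rw [Finset.mem_powerset] at hT
  have h2 := Finset.card_sdiff_of_subset hT
  rw [Nat.card_Icc, Nat.add_sub_cancel] at h2
  rw [uS_eq, fS_card (n - T.card) (Finset.Icc 1 n \ T) (Finset.Icc 1 (n - T.card)) h2 (by simp)]

/-- Match of `123` or `1324` at the first position. -/
def P0 (l : List ℕ) : Prop :=
  (∃ a b c t, l = a :: b :: c :: t ∧ a < b ∧ b < c) ∨
  (∃ a b c d t, l = a :: b :: c :: d :: t ∧ a < c ∧ c < b ∧ b < d)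

theorem redL_123 (l : List ℕ) : redL l = [1, 2, 3] ↔ ∃ a b c, l = [a, b, c] ∧ a < b ∧ b < c := by
  constructor
  · intro h
    have hl := congrArg List.length h
    simp only [redL, List.length_map] at hl
    match l, hl with
    | [a, b, c], _ =>
      refine ⟨a, b, c, rfl, ?_⟩
      simp [redL, List.countP_cons] at h
      obtain ⟨h1, h2, h3⟩ := h
      split_ifs at h1 h2 h3 <;> omega
  · rintro ⟨a, b, c, rfl, h1, h2⟩
    simp [redL, List.countP_cons, h1, h2, h1.trans h2, h1.le, h2.le, (h1.trans h2).le]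

theorem redL_1324 (l : List ℕ) : redL l = [1, 3, 2, 4] ↔
    ∃ a b c d, l = [a, b, c, d] ∧ a < c ∧ c < b ∧ b < d := by
  constructor
  · intro h
    have hl := congrArg List.length h
    simp only [redL, List.length_map] at hl
    match l, hl with
    | [a, b, c, d], _ =>
      refine ⟨a, b, c, d, rfl, ?_⟩
      simp [redL, List.countP_cons] at h
      obtain ⟨h1, h2, h3, h4⟩ := h
      split_ifs at h1 h2 h3 h4 <;> omega
  · rintro ⟨a, b, c, d, rfl, h1, h2, h3⟩
    have e1 := h1.trans h2
    have e2 := h2.trans h3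
    have e3 := e1.trans h3
    simp [redL, List.countP_cons, h1, h2, h3, e1, e2, e3, h1.le, h2.le, h3.le, e1.le, e2.le, e3.le]

theorem P0_iff (l : List ℕ) : P0 l ↔ ∃ j : ℕ, 1 ≤ j ∧ j + 1 ≤ l.length ∧
    redL (l.take (j + 1)) ∈ ({[1, 3, 2, 4], [1, 2, 3]} : Set (List ℕ)) := by
  simp only [Set.mem_insert_iff, Set.mem_singleton_iff, redL_123, redL_1324]
  constructor
  · rintro (⟨a, b, c, t, rfl, h1, h2⟩ | ⟨a, b, c, d, t, rfl, h⟩)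
    · exact ⟨2, by omega, by simp, Or.inr ⟨a, b, c, by simp, h1, h2⟩⟩
    · exact ⟨3, by omega, by simp, Or.inl ⟨a, b, c, d, by simp, h⟩⟩
  · rintro ⟨j, -, -, ⟨a, b, c, d, h, h2⟩ | ⟨a, b, c, h, h2⟩⟩
    · right
      refine ⟨a, b, c, d, l.drop (j + 1), ?_, h2⟩
      conv_lhs => rw [← List.take_append_drop (j + 1) l, h]
      rfl
    · left
      refine ⟨a, b, c, l.drop (j + 1), ?_, h2⟩
      conv_lhs => rw [← List.take_append_drop (j + 1) l, h]
      rfl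

theorem HM_nil (Γ : Set (List ℕ)) : ¬ HasMatch Γ [] := by
  rintro ⟨i, j, h1, h2, -⟩
  simp at h2

theorem HM_cons (x : ℕ) (l : List ℕ) : HasMatch {[1, 3, 2, 4], [1, 2, 3]} (x :: l) ↔
    P0 (x :: l) ∨ HasMatch {[1, 3, 2, 4], [1, 2, 3]} l := by
  rw [P0_iff]
  constructor
  · rintro ⟨i, j, h1, h2, h3⟩
    cases i with
    | zero => left; exact ⟨j, h1, by omega, by simpa using h3⟩
    | succ i => right; exact ⟨i, j, h1, by simp at h2; omega, by simpa using h3⟩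
  · rintro (⟨j, h1, h2, h3⟩ | ⟨i, j, h1, h2, h3⟩)
    · exact ⟨0, j, h1, by omega, by simpa using h3⟩
    · exact ⟨i + 1, j, h1, by simp; omega, by simpa using h3⟩

theorem P0_desc {a b : ℕ} {l : List ℕ} (h : b < a) : ¬ P0 (a :: b :: l) := by
  rintro (⟨_, _, _, _, h1, h2, h3⟩ | ⟨_, _, _, _, _, h1, h2, h3, h4⟩) <;>
    simp at h1 <;> omega

theorem P0_one {a : ℕ} : ¬ P0 [a] := by
  rintro (⟨_, _, _, _, h1, h2, h3⟩ | ⟨_, _, _, _, _, h1, h2, h3, h4⟩) <;>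
    simp at h1

theorem P0_two {a b : ℕ} : ¬ P0 [a, b] := by
  rintro (⟨_, _, _, _, h1, h2, h3⟩ | ⟨_, _, _, _, _, h1, h2, h3, h4⟩) <;>
    simp at h1

/-- Decomposition of a list into bricks. -/
def br : List ℕ → List (ℕ × ℕ)
  | [] => []
  | [a] => [(a, a)]
  | a :: b :: l => if a < b then (a, b) :: br l else (a, a) :: br (b :: l)

theorem fl_br (l : List ℕ) : fl (br l) = l := by
  fun_induction br l with
  | case1 => rfl
  | case2 a => simp [cells]
  | case3 a b l h ih => simp [ih, cells, h.ne]
  | case4 a b l h ih => simp [ih, cells]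

theorem br_good (l : List ℕ) : ∀ p ∈ br l, p.1 ≤ p.2 := by
  fun_induction br l with
  | case1 => simp
  | case2 a => simp
  | case3 a b l h ih => simpa [h.le] using ih
  | case4 a b l h ih => simpa using ih

theorem br_head (a : ℕ) (l : List ℕ) : ∃ q L, br (a :: l) = q :: L ∧ q.1 = a ∧
    (q.2 = a ∨ ∃ t, l = q.2 :: t) := by
  cases l with
  | nil => exact ⟨(a, a), [], rfl, rfl, Or.inl rfl⟩
  | cons b l =>
    by_cases h : a < b
    · exact ⟨(a, b), br l, by simp [br, h], rfl, Or.inr ⟨l, rfl⟩⟩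
    · exact ⟨(a, a), br (b :: l), by simp [br, h], rfl, Or.inl rfl⟩

theorem br_chain (l : List ℕ) (hd : l.Nodup) (hm : ¬ HasMatch {[1, 3, 2, 4], [1, 2, 3]} l) :
    List.IsChain (fun p q => ¬ Rb p q) (br l) := by
  fun_induction br l with
  | case1 => simp
  | case2 a => simp
  | case3 a b l h ih =>
    rw [HM_cons, HM_cons] at hm
    push Not at hm
    have ih := ih (by simp at hd; exact hd.2.2) hm.2.2
    cases l with
    | nil => simp [br]
    | cons c l =>
      obtain ⟨q, L, hq, hq1, hq2⟩ := br_head c l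
      rw [hq] at ih ⊢
      rw [List.isChain_cons_cons]
      refine ⟨?_, ih⟩
      rintro ⟨r1, r2⟩
      simp only at r1 r2
      apply hm.1
      have hbc : b ≠ c := by simp at hd; tauto
      by_cases hlt : b < c
      · exact Or.inl ⟨a, b, c, l, rfl, h, hlt⟩
      · rcases hq2 with hq2 | ⟨t, rfl⟩
        · omega
        · exact Or.inr ⟨a, b, c, q.2, t, rfl, by omega, by omega, r2⟩
  | case4 a b l h ih =>
    rw [HM_cons] at hm
    push Not at hm
    have ih := ih (by simp at hd ⊢; tauto) hm.2
    obtain ⟨q, L, hq, hq1, hq2⟩ := br_head b l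
    rw [hq] at ih ⊢
    rw [List.isChain_cons_cons]
    refine ⟨?_, ih⟩
    rintro ⟨r1, r2⟩
    simp only at r1 r2
    omega

theorem fl_cons_eq {q : ℕ × ℕ} {L} : ∃ t, fl (q :: L) = q.1 :: t := by
  rw [fl_cons]; unfold cells; split_ifs <;> simp

theorem desL_cons (a b : ℕ) (l : List ℕ) :
    desL (a :: b :: l) = desL (b :: l) + if b < a then 1 else 0 := by
  simp [desL, List.countP_cons]

theorem fl_chain (L : List (ℕ × ℕ)) (hg : ∀ p ∈ L, p.1 ≤ p.2) (hd : (fl L).Nodup)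
    (hc : List.IsChain (fun p q => ¬ Rb p q) L) :
    ¬ HasMatch {[1, 3, 2, 4], [1, 2, 3]} (fl L) ∧ br (fl L) = L ∧
      (L ≠ [] → 1 + desL (fl L) = L.length) := by
  induction L with
  | nil => exact ⟨HM_nil _, rfl, by simp⟩
  | cons p L ih =>
    obtain ⟨a, b⟩ := p
    have hg1 : a ≤ b := hg (a, b) (by simp)
    have ih := ih (fun q hq => hg q (by simp [hq]))
      (by rw [fl_cons] at hd; exact hd.of_append_right) hc.tail
    obtain ⟨ih1, ih2, ih3⟩ := ih
    cases L with
    | nil =>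
      by_cases hab : a = b
      · subst hab
        refine ⟨?_, by simp [cells, br], by simp [cells, desL]⟩
        simp only [fl_cons, cells, fl_nil, if_true, List.append_nil]
        rw [HM_cons]
        simp [P0_one, HM_nil]
      · have hlt : a < b := by omega
        refine ⟨?_, by simp [cells, br, hab, hlt], by simp [cells, desL, hab, hg1]⟩
        simp only [fl_cons, cells, fl_nil, List.append_nil, hab, if_false]
        rw [HM_cons, HM_cons]
        simp [P0_one, P0_two, HM_nil]
    | cons q L =>
      rw [List.isChain_cons_cons] at hc
      have hR : ¬ (a < q.1 ∧ b < q.2) := hc.1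
      have hgq : q.1 ≤ q.2 := hg q (by simp)
      obtain ⟨t, ht⟩ := fl_cons_eq (q := q) (L := L)
      have ih3 := ih3 (by simp)
      rw [fl_cons (a, b) (q :: L)] at hd ⊢
      by_cases hab : a = b
      · subst hab
        have hca : cells (a, a) = [a] := by simp [cells]
        rw [hca] at hd ⊢
        rw [ht] at ih1 ih2 ih3 hd ⊢
        simp only [List.cons_append, List.nil_append] at hd ⊢
        have hne : a ≠ q.1 := by simp at hd; tauto
        have hlt : q.1 < a := by omega
        refine ⟨?_, ?_, fun _ => ?_⟩
        · rw [HM_cons]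
          have := P0_desc (l := t) hlt
          tauto
        · rw [br, if_neg (by omega), ih2]
        · rw [desL_cons, if_pos hlt]; simp at ih3 ⊢; omega
      · have hlt : a < b := by omega
        have hca : cells (a, b) = [a, b] := by simp [cells, hab]
        rw [hca] at hd ⊢
        have hbq : b ≠ q.1 := by rw [ht] at hd; simp at hd; tauto
        have hqb : q.1 < b := by omega
        refine ⟨?_, ?_, fun _ => ?_⟩
        · simp only [List.cons_append, List.nil_append]
          rw [HM_cons, HM_cons]
          have h2 : ¬ P0 (b :: fl (q :: L)) := by rw [ht]; exact P0_desc hqb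
          have h1 : ¬ P0 (a :: b :: fl (q :: L)) := by
            rintro (⟨a', b', c', t', e, r1, r2⟩ | ⟨a', b', c', d', t', e, r1, r2, r3⟩)
            · rw [ht] at e
              simp at e
              omega
            · by_cases hq : q.1 = q.2
              · -- the second brick is a singleton, followed by a smaller entry
                cases L with
                | nil =>
                  simp [cells, hq] at e
                | cons r L =>
                  obtain ⟨t2, ht2⟩ := fl_cons_eq (q := r) (L := L)
                  rw [fl_cons, ht2] at e
                  simp [cells, hq] at e
                  rw [List.isChain_cons_cons] at hc
                  have hR2 : ¬ (q.1 < r.1 ∧ q.2 < r.2) := hc.2.1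
                  have hgr : r.1 ≤ r.2 := hg r (by simp)
                  omega
              · rw [fl_cons] at e
                simp [cells, hq] at e
                omega
          tauto
        · simp only [List.cons_append, List.nil_append]
          rw [br, if_pos hlt, ih2]
        · simp only [List.cons_append, List.nil_append]
          rw [desL_cons, ht, desL_cons, if_pos hqb, if_neg (by omega), ← ht]
          simp at ih3 ⊢; omega

theorem NM_eq (n : ℕ) : NMpoly {[1, 3, 2, 4], [1, 2, 3]} n = fS (Finset.Icc 1 n) := by
  classical
  have hmem : ∀ l, l ∈ NMfinset {[1, 3, 2, 4], [1, 2, 3]} n ↔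
      (l.Nodup ∧ ∀ x, x ∈ l ↔ x ∈ Finset.Icc 1 n) ∧
        ¬ HasMatch {[1, 3, 2, 4], [1, 2, 3]} l := by
    intro l
    unfold NMfinset
    rw [Finset.mem_filter, List.mem_toFinset, List.mem_permutations]
    refine and_congr_left fun _ => ?_
    have hr : ∀ x, x ∈ List.range' 1 n ↔ x ∈ Finset.Icc 1 n := by
      intro x; simp [List.mem_range'_1]; omega
    constructor
    · intro h
      exact ⟨h.nodup_iff.2 List.nodup_range', fun x => by rw [h.mem_iff, hr]⟩
    · rintro ⟨h1, h2⟩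
      rw [List.perm_ext_iff_of_nodup h1 List.nodup_range']
      intro x; rw [h2, hr]
  unfold NMpoly
  split_ifs with hn
  · subst hn
    rw [fS, Finset.sum_eq_single_of_mem []]
    · simp
    · simp [mem_BL, IsB]
    · intro L hL hne
      cases L with
      | nil => simp at hne
      | cons p L =>
        rw [Finset.mem_filter, mem_BL] at hL
        have := hL.1.mem1 (List.mem_cons_self (a := p) (l := L))
        simp at this
  · rw [fS]
    refine Finset.sum_bij' (fun l _ => br l) (fun L _ => fl L) ?_ ?_ ?_ ?_ ?_
    · intro l hl
      rw [hmem] at hl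
      rw [Finset.mem_filter, mem_BL]
      refine ⟨⟨br_good l, ?_, ?_⟩, br_chain l hl.1.1 hl.2⟩
      · rw [fl_br]; exact hl.1.1
      · rw [fl_br]; exact hl.1.2
    · intro L hL
      rw [Finset.mem_filter, mem_BL] at hL
      rw [hmem]
      exact ⟨⟨hL.1.2.1, hL.1.2.2⟩, (fl_chain L hL.1.1 hL.1.2.1 hL.2).1⟩
    · intro l hl
      exact fl_br l
    · intro L hL
      rw [Finset.mem_filter, mem_BL] at hL
      exact (fl_chain L hL.1.1 hL.1.2.1 hL.2).2.1
    · intro l hl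
      rw [hmem] at hl
      have h := (fl_chain (br l) (br_good l) (by rw [fl_br]; exact hl.1.1)
        (br_chain l hl.1.1 hl.2)).2.2 (by
          intro h
          have h2 := fl_br l
          rw [h] at h2
          have := (hl.1.2 1).2 (by simp; omega)
          rw [← h2] at this
          simp at this)
      rw [fl_br] at h
      rw [h]

theorem stmt1 (Γ : Set (List ℕ)) (hΓ : Γ = {[1, 3, 2, 4], [1, 2, 3]})
    (U : ℤ → Polynomial ℚ)
    (hUneg : ∀ m : ℤ, m < 0 → U m = 0)
    (hU0 : U 0 = 1)
    (hUrec : ∀ n : ℕ, 1 ≤ n →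
      ∑ k ∈ Finset.range (n + 1), (n.choose k : ℚ) • (U (k : ℤ) * NMpoly Γ (n - k)) = 0) :
    U 1 = -X ∧ ∀ n : ℕ, 2 ≤ n →
      U (n : ℤ) = -X * U ((n : ℤ) - 1) - X * U ((n : ℤ) - 2) +
        ∑ k ∈ Finset.Icc 2 (n / 2),
          (-X : Polynomial ℚ) ^ k * (catalan (k - 1) : Polynomial ℚ) * U ((n : ℤ) - 2 * k) := by
  subst hΓ
  have hW0 : Wt 0 0 = 1 := by simp [Wt]
  have hN0 : NMpoly {[1, 3, 2, 4], [1, 2, 3]} 0 = 1 := by simp [NMpoly]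
  have hU : ∀ n : ℕ, U n = Wt n 0 := by
    intro n
    induction n using Nat.strong_induction_on with
    | _ n ih =>
      rcases Nat.eq_zero_or_pos n with rfl | hn
      · simpa [hW0] using hU0
      · have h1 := hUrec n hn
        have h2 := uf_rec n hn
        simp only [← NM_eq] at h2
        rw [Finset.sum_range_succ] at h1 h2
        rw [Finset.sum_congr rfl (fun k hk => by rw [ih k (Finset.mem_range.1 hk)])] at h1
        rw [← h2] at h1
        have h3 := add_left_cancel h1
        simpa [hN0] using h3
  constructor
  · have := hU 1
    simpa [Wt] using this
  · intro n hn
    have h := Wt_rec n hn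
    rw [hU, h]
    have a1 : U ((n : ℤ) - 1) = Wt (n - 1) 0 := by rw [← hU]; congr 1; omega
    have a2 : U ((n : ℤ) - 2) = Wt (n - 2) 0 := by rw [← hU]; congr 1; omega
    rw [a1, a2]
    congr 1
    refine Finset.sum_congr rfl fun k hk => ?_
    rw [Finset.mem_Icc] at hk
    have a3 : U ((n : ℤ) - 2 * k) = Wt (n - 2 * k) 0 := by rw [← hU]; congr 1; omega
    rw [a3]
end
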